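/- For every positive integer n, the number of representations of n by x1^2 + 2(x2^2+x3^2+x4^2+x5^2+x6^2) + 4(x7^2+x8^2) equals (8/11)σ_{3;χ8,1}(n) + (2/11)σ_{3;1,χ8}(n/2) + (2/11)a1(n) + (12/11)a2(n) + (48/11)a1(n/2) + (16/11)a2(n/2), with terms of non-integer argument interpreted as 0. -/

import Mathlib

open Complex Real Finset

/-- The Dedekind eta function `η(z) = q^{1/24} ∏ (1 - q^m)`, `q = e^{2πiz}`. -/
noncomputable def dedekindEta (z : ℂ) : ℂ :=
  Complex.exp (Real.pi * Complex.I * z / 12) *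
    ∏' m : ℕ, (1 - Complex.exp (2 * Real.pi * Complex.I * (m + 1) * z))

/-- `repCount a n` is the number of `(x₁,…,x₈) ∈ ℤ⁸` with `∑ aᵢ xᵢ² = n`. -/
noncomputable def repCount (a : Fin 8 → ℕ) (n : ℕ) : ℕ :=
  Nat.card {x : Fin 8 → ℤ // ∑ i, (a i : ℤ) * x i ^ 2 = (n : ℤ)}

/-- `σ_{3;1,χ₈}(n) = ∑_{d ∣ n} χ₈(d) d³`. -/
def sigmaOneChi8 (n : ℕ) : ℤ := ∑ d ∈ n.divisors, ZMod.χ₈ (d : ZMod 8) * (d : ℤ) ^ 3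

/-- `σ_{3;χ₈,1}(n) = ∑_{d ∣ n} χ₈(n/d) d³`. -/
def sigmaChi8One (n : ℕ) : ℤ := ∑ d ∈ n.divisors, ZMod.χ₈ ((n / d : ℕ) : ZMod 8) * (d : ℤ) ^ 3

/-- `f(n/2)` when `2 ∣ n`, and `0` otherwise. -/
def half (f : ℕ → ℤ) (n : ℕ) : ℚ := if 2 ∣ n then (f (n / 2) : ℚ) else 0

namespace RF

/-- Convolution form of a product of two bilateral sums. -/
lemma conv_hasSum {𝕜 : Type*} [RCLike 𝕜] {f g : ℤ → 𝕜} {F G : 𝕜} {c : ℤ → 𝕜}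
    (hf : HasSum f F) (hg : HasSum g G)
    (hc : ∀ k, HasSum (fun b => f (b + k) * g b) (c k)) : HasSum c (F * G) := by
  have hfn : Summable fun m => ‖f m‖ := hf.summable.norm
  have hgn : Summable fun m => ‖g m‖ := hg.summable.norm
  have h1 : HasSum (fun p : ℤ × ℤ => f p.1 * g p.2) (F * G) :=
    hf.mul hg (summable_mul_of_summable_norm hfn hgn)
  let e : ℤ × ℤ ≃ ℤ × ℤ :=
    { toFun := fun p => (p.2 + p.1, p.2)
      invFun := fun p => (p.1 - p.2, p.2)
      left_inv := fun p => by simp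
      right_inv := fun p => by simp }
  have h2 : HasSum (fun p : ℤ × ℤ => f (p.2 + p.1) * g p.2) (F * G) := by
    have := (e.hasSum_iff (f := fun p : ℤ × ℤ => f p.1 * g p.2)).2 h1
    exact this
  exact h2.prod_fiberwise hc

/-- Telescoping over the integers. -/
lemma telescope_one {𝕜 : Type*} [RCLike 𝕜] {g : ℤ → 𝕜} {lp lm : 𝕜}
    (hp : Filter.Tendsto (fun n : ℕ => g n) Filter.atTop (nhds lp))
    (hm : Filter.Tendsto (fun n : ℕ => g (-(n : ℤ))) Filter.atTop (nhds lm))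
    (hs : Summable fun b : ℤ => g (b + 1) - g b) :
    HasSum (fun b : ℤ => g (b + 1) - g b) (lp - lm) := by
  have h1 : HasSum (fun n : ℕ => g ((n : ℤ) + 1) - g n) (lp - g 0) := by
    have hs1 : Summable (fun n : ℕ => g ((n : ℤ) + 1) - g n) :=
      hs.comp_injective (i := fun n : ℕ => (n : ℤ)) Nat.cast_injective
    rw [hasSum_iff_tendsto_nat_of_summable_norm hs1.norm]
    have : (fun n : ℕ => ∑ i ∈ Finset.range n, (g ((i : ℤ) + 1) - g i)) = fun n : ℕ => g n - g 0 := by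
      funext n
      have := Finset.sum_range_sub (fun n : ℕ => g n) n
      simpa using this
    rw [this]
    exact hp.sub_const _
  have h2 : HasSum (fun n : ℕ => g (-((n : ℤ) + 1) + 1) - g (-((n : ℤ) + 1))) (g 0 - lm) := by
    have hs1 : Summable (fun n : ℕ => g (-((n : ℤ) + 1) + 1) - g (-((n : ℤ) + 1))) :=
      hs.comp_injective (i := fun n : ℕ => -((n : ℤ) + 1)) (fun a b h => by simpa using h)
    rw [hasSum_iff_tendsto_nat_of_summable_norm hs1.norm]
    have : (fun n : ℕ => ∑ i ∈ Finset.range n, (g (-((i : ℤ) + 1) + 1) - g (-((i : ℤ) + 1))))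
        = fun n : ℕ => g 0 - g (-(n : ℤ)) := by
      funext n
      have := Finset.sum_range_sub' (fun n : ℕ => g (-(n : ℤ))) n
      simpa using this
    rw [this]
    exact hm.const_sub _
  have := HasSum.of_nat_of_neg_add_one (f := fun b : ℤ => g (b + 1) - g b) h1 h2
  simpa using this

lemma telescope {𝕜 : Type*} [RCLike 𝕜] {g : ℤ → 𝕜} {d : 𝕜}
    (h1 : HasSum (fun b : ℤ => g (b + 1) - g b) d) (k : ℤ) :
    HasSum (fun b : ℤ => g (b + k) - g b) (k * d) := by
  induction k using Int.induction_on with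
  | zero => simpa using hasSum_zero
  | succ i ih =>
    have h2 : HasSum (fun b : ℤ => g (b + i + 1) - g (b + i)) d := by
      have := ((Equiv.addRight (i : ℤ)).hasSum_iff (f := fun b : ℤ => g (b + 1) - g b)).2 h1
      exact this
    convert ih.add h2 using 1
    · funext b; rw [← add_assoc]; ring
    · push_cast; ring
  | pred i ih =>
    have h2 : HasSum (fun b : ℤ => g (b + (-i - 1) + 1) - g (b + (-i - 1))) d := by
      have := ((Equiv.addRight (-(i : ℤ) - 1)).hasSum_iff (f := fun b : ℤ => g (b + 1) - g b)).2 h1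
      exact this
    have h3 := ih.sub h2
    have e1 : (fun b : ℤ => g (b + -(i : ℤ)) - g b - (g (b + (-(i : ℤ) - 1) + 1) - g (b + (-(i : ℤ) - 1))))
        = fun b : ℤ => g (b + (-(i : ℤ) - 1)) - g b := by
      funext b
      have : b + (-(i : ℤ) - 1) + 1 = b + -i := by ring
      rw [this]; ring
    have e2 : ((-(i : ℤ) : ℤ) : 𝕜) * d - d = ((-(i : ℤ) - 1 : ℤ) : 𝕜) * d := by push_cast; ring
    rw [e1, e2] at h3
    exact h3

/-- A sum over `ℤ` of an odd function vanishes. -/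
lemma odd_hasSum {f : ℤ → ℝ} (hs : Summable f) (ho : ∀ m, f (-m) = - f m) : HasSum f 0 := by
  have h := hs.hasSum
  have h2 : HasSum (fun m => f (-m)) (∑' m, f m) := (Equiv.neg ℤ).hasSum_iff.2 h
  simp only [ho] at h2
  have := h2.unique h.neg
  have h0 : (∑' m, f m) = 0 := by linarith
  rwa [h0] at h

lemma summable_q_abs {q : ℝ} (h0 : 0 < q) (h1 : q < 1) : Summable fun m : ℤ => q ^ m.natAbs := by
  have hg := summable_geometric_of_lt_one h0.le h1
  refine Summable.of_nat_of_neg ?_ ?_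
  · simpa using hg
  · simpa using hg

lemma min_eq {q : ℝ} (h0 : 0 < q) (h1 : q < 1) (m : ℤ) :
    q ^ m ≤ q ^ m.natAbs ∨ (q ^ m)⁻¹ ≤ q ^ m.natAbs := by
  rcases le_total 0 m with h | h
  · left
    obtain ⟨n, rfl⟩ := Int.eq_ofNat_of_zero_le h
    simp
  · right
    obtain ⟨n, hn⟩ := Int.exists_eq_neg_ofNat h
    subst hn
    simp

/-- Summability criterion. -/
lemma summable_of_bound {q : ℝ} (h0 : 0 < q) (h1 : q < 1) {f : ℤ → ℝ} (C : ℝ) 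
    (h : ∀ m, |f m| ≤ C * q ^ m ∧ |f m| ≤ C * (q ^ m)⁻¹) : Summable f := by
  have hC : 0 ≤ C := by
    have := (h 0).1
    simp at this
    exact (abs_nonneg _).trans this
  refine Summable.of_norm_bounded ((summable_q_abs h0 h1).mul_left C) fun m => ?_
  rw [Real.norm_eq_abs]
  rcases min_eq h0 h1 m with h2 | h2
  · exact (h m).1.trans (mul_le_mul_of_nonneg_left h2 hC)
  · exact (h m).2.trans (mul_le_mul_of_nonneg_left h2 hC)

/-- hyperbolic functions in terms of `u = e^{-x}` -/
noncomputable def S (u : ℝ) : ℝ := 2 * u / (1 + u ^ 2)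
noncomputable def C (u : ℝ) : ℝ := (u + u ^ 3) / (1 + u ^ 4)
noncomputable def H (u : ℝ) : ℝ := (u - u ^ 3) / (1 + u ^ 4)
noncomputable def TH (u : ℝ) : ℝ := (1 - u ^ 2) / (1 + u ^ 2)

lemma S_inv {u : ℝ} (hu : 0 < u) : S u⁻¹ = S u := by unfold S; field_simp; ring
lemma C_inv {u : ℝ} (hu : 0 < u) : C u⁻¹ = C u := by unfold C; field_simp; ring
lemma H_inv {u : ℝ} (hu : 0 < u) : H u⁻¹ = - H u := by unfold H; field_simp; ring
lemma TH_inv {u : ℝ} (hu : 0 < u) : TH u⁻¹ = - TH u := by unfold TH; field_simp; ring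

lemma S_pos {u : ℝ} (hu : 0 < u) : 0 < S u := by unfold S; positivity
lemma C_pos {u : ℝ} (hu : 0 < u) : 0 < C u := by unfold C; positivity

lemma S_le {u : ℝ} (hu : 0 < u) : |S u| ≤ 2 * u := by
  rw [abs_of_pos (S_pos hu)]; unfold S; rw [div_le_iff₀ (by positivity)]; nlinarith [pow_pos hu 3]
lemma C_le {u : ℝ} (hu : 0 < u) : |C u| ≤ 2 * u := by
  rw [abs_of_pos (C_pos hu)]; unfold C; rw [div_le_iff₀ (by positivity)]
  nlinarith [pow_pos hu 3, pow_pos hu 5, mul_nonneg hu.le (sq_nonneg (u^2-1))]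
lemma H_le_C {u : ℝ} (hu : 0 < u) : |H u| ≤ C u := by
  unfold H C; rw [abs_div, abs_of_pos (show 0 < 1 + u ^ 4 by positivity)]
  gcongr
  rw [abs_le]; constructor <;> nlinarith [pow_pos hu 3]
lemma H_le {u : ℝ} (hu : 0 < u) : |H u| ≤ 2 * u := 
  (H_le_C hu).trans ((le_abs_self _).trans (C_le hu))

lemma S_le_one {u : ℝ} (hu : 0 < u) : |S u| ≤ 1 := by
  rw [abs_of_pos (S_pos hu)]; unfold S; rw [div_le_iff₀ (by positivity)]; nlinarith [sq_nonneg (u-1)]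

section
variable {q : ℝ} (h0 : 0 < q) (h1 : q < 1)
include h0 h1

lemma summable_S : Summable fun m : ℤ => S (q ^ m) := by
  refine summable_of_bound h0 h1 2 fun m => ⟨S_le (zpow_pos h0 m), ?_⟩
  rw [← S_inv (zpow_pos h0 m)]; exact S_le (inv_pos.2 (zpow_pos h0 m))
lemma summable_C : Summable fun m : ℤ => C (q ^ m) := by
  refine summable_of_bound h0 h1 2 fun m => ⟨C_le (zpow_pos h0 m), ?_⟩
  rw [← C_inv (zpow_pos h0 m)]; exact C_le (inv_pos.2 (zpow_pos h0 m))
lemma summable_H : Summable fun m : ℤ => H (q ^ m) := by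
  refine summable_of_bound h0 h1 2 fun m => ⟨H_le (zpow_pos h0 m), ?_⟩
  rw [← abs_neg, ← H_inv (zpow_pos h0 m)]; exact H_le (inv_pos.2 (zpow_pos h0 m))

lemma TH_tendsto_p : Filter.Tendsto (fun n : ℕ => TH (q ^ (n : ℤ))) Filter.atTop (nhds 1) := by
  have h := tendsto_pow_atTop_nhds_zero_of_lt_one h0.le h1
  have : Filter.Tendsto TH (nhds 0) (nhds (TH 0)) := by
    have : ContinuousAt TH 0 := by
      unfold TH
      refine ContinuousAt.div (by fun_prop) (by fun_prop) (by norm_num)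
    exact this
  have h3 := this.comp h
  simpa [TH, Function.comp_def] using h3

lemma TH_sub_le {u : ℝ} (hu : 0 < u) : |TH (u * q) - TH u| ≤ 2 * q⁻¹ * S u := by
  have e : TH (u * q) - TH u = 2 * u ^ 2 * (1 - q ^ 2) / ((1 + (u*q)^2) * (1 + u^2)) := by
    unfold TH; field_simp; ring
  have hq2 : 0 < 1 - q ^ 2 := by nlinarith
  rw [e, abs_of_pos (by positivity)]
  have e2 : 2 * q⁻¹ * S u = (4 * u * (1 + (u*q)^2) / q) / ((1 + (u*q)^2) * (1 + u^2)) := by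
    unfold S; field_simp; ring
  rw [e2]
  gcongr
  rw [le_div_iff₀ h0]
  have h3 : u * q * 2 ≤ 1 + (u*q)^2 := by nlinarith [sq_nonneg (u*q-1)]
  have h4 : 2 * u ^ 2 * (1 - q^2) * q ≤ 2 * u^2 * q := by
    have : 0 < u^2*q := by positivity
    nlinarith
  have h5 := mul_le_mul_of_nonneg_left h3 hu.le
  nlinarith [mul_pos (pow_pos hu 2) h0]

lemma TH_telescope (k : ℤ) : HasSum (fun b : ℤ => TH (q ^ (b + k)) - TH (q ^ b)) (2 * k) := by
  have hs : Summable (fun b : ℤ => TH (q ^ (b + 1)) - TH (q ^ b)) := by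
    refine Summable.of_norm_bounded (((summable_S h0 h1).mul_left (2 * q⁻¹))) fun m => ?_
    rw [zpow_add₀ h0.ne', zpow_one, Real.norm_eq_abs]
    exact TH_sub_le h0 h1 (zpow_pos h0 m)
  have hm : Filter.Tendsto (fun n : ℕ => TH (q ^ (-(n : ℤ)))) Filter.atTop (nhds (-1)) := by
    have := (TH_tendsto_p h0 h1).neg
    refine this.congr fun n => ?_
    rw [zpow_neg, TH_inv (zpow_pos h0 _)]
  have h2 : HasSum (fun b : ℤ => TH (q ^ (b + 1)) - TH (q ^ b)) (1 - -1) :=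
    telescope_one (𝕜 := ℝ) (g := fun b => TH (q ^ b)) (TH_tendsto_p h0 h1) hm hs
  have h3 := telescope (𝕜 := ℝ) (g := fun b => TH (q ^ b)) h2 k
  have e : (k : ℝ) * (1 - -1) = 2 * k := by ring
  rw [e] at h3
  exact h3

end

/-- the four Lambert-type series -/
noncomputable def A (q : ℝ) : ℝ := ∑' m : ℤ, S (q ^ m)
noncomputable def L (q : ℝ) : ℝ := ∑' m : ℤ, C (q ^ m)
noncomputable def An (q : ℝ) : ℝ := ∑' m : ℤ, (-1) ^ m * S (q ^ m)
noncomputable def Ln (q : ℝ) : ℝ := ∑' m : ℤ, (-1) ^ m * C (q ^ m)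

end RF

namespace RF

lemma sq_zpow' (q : ℝ) (m : ℤ) : (q ^ 2) ^ m = (q ^ m) ^ 2 := by
  rw [← zpow_natCast, ← zpow_natCast, ← zpow_mul, ← zpow_mul, mul_comm]

lemma neg_one_zpow_abs (m : ℤ) : |((-1 : ℝ)) ^ m| = 1 := by
  rw [abs_zpow]; simp

lemma summable_sign {f : ℤ → ℝ} (hf : Summable f) : Summable fun m : ℤ => (-1) ^ m * f m := by
  refine Summable.of_norm_bounded hf.norm fun m => ?_
  rw [norm_mul, Real.norm_eq_abs, neg_one_zpow_abs, one_mul]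

section
variable {q : ℝ} (h0 : 0 < q) (h1 : q < 1)
include h0 h1

lemma hA : HasSum (fun m : ℤ => S (q ^ m)) (A q) := (summable_S h0 h1).hasSum
lemma hL : HasSum (fun m : ℤ => C (q ^ m)) (L q) := (summable_C h0 h1).hasSum
lemma hAn : HasSum (fun m : ℤ => (-1) ^ m * S (q ^ m)) (An q) :=
  (summable_sign (summable_S h0 h1)).hasSum
lemma hLn : HasSum (fun m : ℤ => (-1) ^ m * C (q ^ m)) (Ln q) :=
  (summable_sign (summable_C h0 h1)).hasSum
lemma hB : HasSum (fun m : ℤ => S ((q ^ m) ^ 2)) (A (q ^ 2)) := by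
  have := hA (pow_pos h0 2) (pow_lt_one₀ h0.le h1 two_ne_zero)
  simpa only [sq_zpow'] using this
lemma hL2 : HasSum (fun m : ℤ => C ((q ^ m) ^ 2)) (L (q ^ 2)) := by
  have := hL (pow_pos h0 2) (pow_lt_one₀ h0.le h1 two_ne_zero)
  simpa only [sq_zpow'] using this
lemma hH : HasSum (fun m : ℤ => H (q ^ m)) 0 :=
  odd_hasSum (summable_H h0 h1) fun m => by rw [zpow_neg, H_inv (zpow_pos h0 m)]
lemma hHn : HasSum (fun m : ℤ => (-1) ^ m * H (q ^ m)) 0 :=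
  odd_hasSum (summable_sign (summable_H h0 h1)) fun m => by
    rw [zpow_neg, zpow_neg, H_inv (zpow_pos h0 m), ← inv_zpow]; norm_num

lemma id1 {u r : ℝ} (hu : 0 < u) (hr : 0 < r) :
    S (u * r) * S (u ^ 2) = - S (r ^ 2) * S (u * r) + 2 * C r * C u - 2 * H r * H u := by
  unfold S C H; field_simp; ring

/-- `A(q) A(q²) = L(q)²` -/
lemma AB_eq : A q * A (q ^ 2) = L q ^ 2 := by
  have hc := conv_hasSum (𝕜 := ℝ) (hA h0 h1) (hB h0 h1)
    (c := fun k => - S ((q ^ k) ^ 2) * A q + 2 * C (q ^ k) * L q - 2 * H (q ^ k) * 0) (fun k => by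
      have hs : HasSum (fun b : ℤ => S (q ^ (b + k))) (A q) :=
        ((Equiv.addRight k).hasSum_iff (f := fun b : ℤ => S (q ^ b))).2 (hA h0 h1)
      have := ((hs.mul_left (- S ((q ^ k) ^ 2))).add ((hL h0 h1).mul_left (2 * C (q ^ k)))).sub
        ((hH h0 h1).mul_left (2 * H (q ^ k)))
      refine this.congr_fun ?_
      intro b
      rw [zpow_add₀ h0.ne']
      exact (id1 h0 h1 (zpow_pos h0 b) (zpow_pos h0 k)))
  have h2 := (((hB h0 h1).neg.mul_right (A q)).add (((hL h0 h1).mul_left 2).mul_right (L q))).sub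
    (((hH h0 h1).mul_left 2).mul_right 0)
  have := hc.unique h2
  linarith

lemma AnB_eq : An q * A (q ^ 2) = Ln q ^ 2 := by
  have hc := conv_hasSum (𝕜 := ℝ) (hAn h0 h1) (hB h0 h1)
    (c := fun k => - S ((q ^ k) ^ 2) * An q + 2 * ((-1) ^ k * C (q ^ k)) * Ln q
      - 2 * ((-1) ^ k * H (q ^ k)) * 0) (fun k => by
      have hs : HasSum (fun b : ℤ => (-1) ^ (b + k) * S (q ^ (b + k))) (An q) :=
        ((Equiv.addRight k).hasSum_iff (f := fun b : ℤ => (-1) ^ b * S (q ^ b))).2 (hAn h0 h1)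
      have := ((hs.mul_left (- S ((q ^ k) ^ 2))).add ((hLn h0 h1).mul_left (2 * ((-1) ^ k * C (q ^ k))))).sub
        ((hHn h0 h1).mul_left (2 * ((-1) ^ k * H (q ^ k))))
      refine this.congr_fun ?_
      intro b
      rw [zpow_add₀ h0.ne', zpow_add₀ (by norm_num : (-1 : ℝ) ≠ 0)]
      linear_combination (-1) ^ b * (-1) ^ k * (id1 h0 h1 (zpow_pos h0 b) (zpow_pos h0 k)))
  have h2 := (((hB h0 h1).neg.mul_right (An q)).add (((hLn h0 h1).mul_left 2).mul_right (Ln q))).sub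
    (((hHn h0 h1).mul_left 2).mul_right 0)
  have := hc.unique h2
  linarith

/-- even part -/
lemma even_part {f : ℤ → ℝ} (hf : Summable f) :
    (∑' m, f m) + (∑' m : ℤ, (-1) ^ m * f m) = 2 * ∑' m : ℤ, f (2 * m) := by
  rw [← hf.tsum_add (summable_sign hf), ← tsum_mul_left]
  have hinj : Function.Injective (fun m : ℤ => 2 * m) := fun a b h => by simpa using h
  have := hinj.tsum_eq (f := fun m : ℤ => f m + (-1) ^ m * f m) ?_
  · rw [← this]
    refine tsum_congr fun m => ?_
    rw [zpow_mul]; norm_num; ring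
  · intro m hm
    rcases Int.even_or_odd m with h | h
    · obtain ⟨n, rfl⟩ := h
      exact ⟨n, by ring⟩
    · exfalso; apply hm
      simp only [h.neg_one_zpow]; ring

lemma A_add_An : A q + An q = 2 * A (q ^ 2) := by
  have := even_part h0 h1 (summable_S h0 h1)
  unfold A An
  rw [this]
  congr 1
  refine tsum_congr fun m => ?_
  rw [zpow_mul]; norm_cast
lemma L_add_Ln : L q + Ln q = 2 * L (q ^ 2) := by
  have := even_part h0 h1 (summable_C h0 h1)
  unfold L Ln
  rw [this]
  congr 1
  refine tsum_congr fun m => ?_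
  rw [zpow_mul]; norm_cast

lemma hTH20 : HasSum (fun b : ℤ => TH ((q ^ b) ^ 2) - TH (q ^ b)) 0 := by
  refine odd_hasSum ?_ fun m => ?_
  · refine summable_of_bound h0 h1 2 fun m => ?_
    have key : ∀ u : ℝ, 0 < u → |TH (u ^ 2) - TH u| ≤ 2 * u := by
      intro u hu
      have : TH (u ^ 2) - TH u = 2 * (u ^ 2 * (1 - u ^ 2)) / ((1 + u ^ 4) * (1 + u ^ 2)) := by
        unfold TH; field_simp; ring
      rw [this, abs_div, abs_of_pos (show 0 < (1 + u ^ 4) * (1 + u ^ 2) by positivity),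
        div_le_iff₀ (by positivity), abs_mul, abs_mul, abs_two, abs_of_pos (pow_pos hu 2), mul_assoc 2 u]
      refine mul_le_mul_of_nonneg_left ?_ (by norm_num)
      have h3 : |1 - u ^ 2| ≤ 1 + u ^ 2 := by
        rw [abs_le]; constructor <;> nlinarith
      have h4 : u ≤ 1 + u ^ 4 := by nlinarith [sq_nonneg (u-1), sq_nonneg (u^2-1), sq_nonneg u]
      calc u ^ 2 * |1 - u ^ 2| ≤ u ^ 2 * (1 + u ^ 2) := by gcongr
        _ = u * (u * (1 + u ^ 2)) := by ring
        _ ≤ u * ((1 + u ^ 4) * (1 + u ^ 2)) := by gcongr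
    refine ⟨key _ (zpow_pos h0 m), ?_⟩
    have := key _ (inv_pos.2 (zpow_pos h0 m))
    rw [inv_pow, TH_inv (zpow_pos h0 m), TH_inv (pow_pos (zpow_pos h0 m) 2)] at this
    rw [← abs_neg]
    convert this using 2
    ring
  · rw [zpow_neg, inv_pow, TH_inv (zpow_pos h0 m), TH_inv (pow_pos (zpow_pos h0 m) 2)]; ring

lemma id2 {u r : ℝ} (hu : 0 < u) (hr : 0 < r) :
    C (u * r) * S u = H r * ((TH ((u * r) ^ 2) - TH (u * r)) + (TH (u * r) - TH u))
      + C r * S ((u * r) ^ 2) := by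
  unfold S C H TH; field_simp; ring

lemma shift {f : ℤ → ℝ} {s : ℝ} (hf : HasSum f s) (k : ℤ) : HasSum (fun b => f (b + k)) s :=
  ((Equiv.addRight k).hasSum_iff (f := f)).2 hf

lemma LA_eq : HasSum (fun k : ℤ => 2 * k * H (q ^ k)) (L q * A q - L q * A (q ^ 2)) := by
  have hc := conv_hasSum (𝕜 := ℝ) (hL h0 h1) (hA h0 h1)
    (c := fun k => H (q ^ k) * (0 + 2 * k) + C (q ^ k) * A (q ^ 2)) (fun k => by
      have := (((shift h0 h1 (hTH20 h0 h1) k).add (TH_telescope h0 h1 k)).mul_left (H (q ^ k))).add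
        ((shift h0 h1 (hB h0 h1) k).mul_left (C (q ^ k)))
      refine this.congr_fun ?_
      intro b
      simp only [zpow_add₀ h0.ne']
      exact (id2 h0 h1 (zpow_pos h0 b) (zpow_pos h0 k)))
  have h2 := hc.sub ((hL h0 h1).mul_right (A (q ^ 2)))
  refine h2.congr_fun ?_
  intro k
  ring

lemma zpow_ne_one {k : ℤ} (hk : k ≠ 0) : q ^ k ≠ 1 := by
  intro h
  have := zpow_right_injective₀ h0 h1.ne (a₁ := k) (a₂ := 0) (by simpa using h)
  exact hk this

lemma id3 {u r : ℝ} (hu : 0 < u) (hr : 0 < r) (hr1 : r ≠ 1) :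
    C (u * r) * S (u ^ 2) = 2 * r ^ 2 / (1 - r ^ 4) * H (u * r) - (r + r ^ 3) / (1 - r ^ 4) * H u
     + S r / 2 * C u := by
  have : 1 - r ^ 4 ≠ 0 := by
    intro h
    apply hr1
    have : (1 - r) * ((1 + r) * (1 + r ^ 2)) = 0 := by linarith
    rcases mul_eq_zero.1 this with h | h
    · linarith
    · have : 0 < ((1 + r) * (1 + r ^ 2)) := by positivity
      linarith
  unfold S C H; field_simp; ring

/-- the diagonal sum -/
lemma LB_eq : HasSum (fun m : ℤ => C (q ^ m) * (2 * S ((q ^ m) ^ 2) - 1)) (L q * (2 * A (q ^ 2) - A q)) := by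
  have hsum : Summable fun m : ℤ => C (q ^ m) * S ((q ^ m) ^ 2) := by
    refine Summable.of_norm_bounded (summable_C h0 h1).norm fun m => ?_
    rw [norm_mul, Real.norm_eq_abs (S _)]
    exact mul_le_of_le_one_right (norm_nonneg _) (S_le_one (pow_pos (zpow_pos h0 m) 2))
  have hc := conv_hasSum (𝕜 := ℝ) (hL h0 h1) (hB h0 h1)
    (c := fun k => if k = 0 then ∑' m : ℤ, C (q ^ m) * S ((q ^ m) ^ 2) else S (q ^ k) / 2 * L q) (fun k => by
      by_cases hk : k = 0
      · subst hk
        simpa using hsum.hasSum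
      simp only [hk, if_false]
      have := (((shift h0 h1 (hH h0 h1) k).mul_left (2 * (q ^ k) ^ 2 / (1 - (q ^ k) ^ 4))).sub
        ((hH h0 h1).mul_left (((q ^ k) + (q ^ k) ^ 3) / (1 - (q ^ k) ^ 4)))).add
        ((hL h0 h1).mul_left (S (q ^ k) / 2))
      rw [mul_zero, mul_zero, sub_zero, zero_add] at this
      refine this.congr_fun ?_
      intro b
      simp only [zpow_add₀ h0.ne']
      exact (id3 h0 h1 (zpow_pos h0 b) (zpow_pos h0 k) (zpow_ne_one h0 h1 hk)))
  have h2 := ((hA h0 h1).div_const 2).mul_right (L q)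
  have h3 := hc.sub h2
  have h4 : HasSum (fun k : ℤ => if k = 0 then (∑' m : ℤ, C (q ^ m) * S ((q ^ m) ^ 2)) - 1 / 2 * L q else 0)
     ((∑' m : ℤ, C (q ^ m) * S ((q ^ m) ^ 2)) - 1 / 2 * L q) := hasSum_ite_eq 0 _
  have h5 := h3.unique (h4.congr_fun (fun k => by
    by_cases hk : k = 0
    · subst hk; simp [S]; norm_num
    · simp [hk]))
  have h6 := (hsum.hasSum.mul_left 2).sub (hL h0 h1)
  have e : 2 * ∑' (i : ℤ), C (q ^ i) * S ((q ^ i) ^ 2) - L q = L q * (2 * A (q ^ 2) - A q) := by linarith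
  rw [e] at h6
  refine h6.congr_fun fun m => by ring

/-- sums of squares -/
noncomputable def T (q : ℝ) : ℝ := ∑' m : ℤ, S (q ^ m) ^ 2
/-- `∑_{k ≠ 0} k / sinh k` -/
noncomputable def K (q : ℝ) : ℝ := ∑' k : ℤ, 2 * k * q ^ k / (1 - (q ^ k) ^ 2)

lemma hT : HasSum (fun m : ℤ => S (q ^ m) ^ 2) (T q) := by
  refine Summable.hasSum ?_
  refine Summable.of_norm_bounded (summable_S h0 h1).norm fun m => ?_
  rw [pow_two, norm_mul, Real.norm_eq_abs (S _)]
  exact mul_le_of_le_one_right (abs_nonneg _) (S_le_one (zpow_pos h0 m))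

lemma one_sub_sq_ne {r : ℝ} (hr : 0 < r) (hr1 : r ≠ 1) : 1 - r ^ 2 ≠ 0 := by
  intro h
  apply hr1
  have : (1 - r) * (1 + r) = 0 := by linarith
  rcases mul_eq_zero.1 this with h | h <;> linarith

lemma id4 {u r : ℝ} (hu : 0 < u) (hr : 0 < r) (hr1 : r ≠ 1) :
    S (u * r) * S u = 2 * r / (1 - r ^ 2) * (TH (u * r) - TH u) := by
  have := one_sub_sq_ne h0 h1 hr hr1
  unfold S TH; field_simp; ring

lemma A_sq_eq : HasSum (fun k : ℤ => 2 * k * q ^ k / (1 - (q ^ k) ^ 2)) ((A q ^ 2 - T q) / 2) := by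
  have hc := conv_hasSum (𝕜 := ℝ) (hA h0 h1) (hA h0 h1)
    (c := fun k => if k = 0 then T q else 2 * (2 * k * q ^ k / (1 - (q ^ k) ^ 2))) (fun k => by
      by_cases hk : k = 0
      · subst hk
        simpa [pow_two] using hT h0 h1
      simp only [hk, if_false]
      have := ((TH_telescope h0 h1 k).mul_left (2 * q ^ k / (1 - (q ^ k) ^ 2)))
      have e : 2 * q ^ k / (1 - (q ^ k) ^ 2) * (2 * k) = 2 * (2 * k * q ^ k / (1 - (q ^ k) ^ 2)) := by ring
      rw [e] at this
      refine this.congr_fun ?_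
      intro b
      simp only [zpow_add₀ h0.ne']
      exact (id4 h0 h1 (zpow_pos h0 b) (zpow_pos h0 k) (zpow_ne_one h0 h1 hk)))
  have h4 : HasSum (fun k : ℤ => if k = 0 then T q else 0) (T q) := hasSum_ite_eq 0 _
  have h5 := (hc.sub h4).div_const 2
  rw [← pow_two] at h5
  refine h5.congr_fun fun k => ?_
  by_cases hk : k = 0
  · subst hk; simp
  · simp [hk]

lemma hK : HasSum (fun k : ℤ => 2 * k * q ^ k / (1 - (q ^ k) ^ 2)) (K q) := (A_sq_eq h0 h1).summable.hasSum

lemma A_sq : A q ^ 2 = T q + 2 * K q := by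
  have := (hK h0 h1).unique (A_sq_eq h0 h1)
  linarith

lemma id5 {u r : ℝ} (hu : 0 < u) (hr : 0 < r) (hr1 : r ≠ 1) :
    C (u * r) * C u = r / (2 * (1 - r ^ 2)) * (TH ((u * r) ^ 2) - TH (u ^ 2))
      + S r / 4 * (S ((u * r) ^ 2) + S (u ^ 2)) := by
  have := one_sub_sq_ne h0 h1 hr hr1
  unfold S TH C; field_simp; ring

lemma AB_eq2 : A q * A (q ^ 2) = T (q ^ 2) + K q := by
  have hq2 := pow_pos h0 2
  have hq21 := pow_lt_one₀ h0.le h1 two_ne_zero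
  have hd : HasSum (fun m : ℤ => C (q ^ m) * C (q ^ m)) (T (q ^ 2) / 2 + A (q ^ 2) / 2) := by
    have := ((hT hq2 hq21).div_const 2).add ((hA hq2 hq21).div_const 2)
    refine this.congr_fun fun m => ?_
    rw [sq_zpow']
    have := zpow_pos h0 m
    unfold C S; field_simp; ring
  have hc := conv_hasSum (𝕜 := ℝ) (hL h0 h1) (hL h0 h1)
    (c := fun k => if k = 0 then T (q ^ 2) / 2 + A (q ^ 2) / 2 else
      (2 * k * q ^ k / (1 - (q ^ k) ^ 2)) / 2 + S (q ^ k) / 2 * A (q ^ 2)) (fun k => by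
      by_cases hk : k = 0
      · subst hk
        simpa using hd
      simp only [hk, if_false]
      have ht := TH_telescope hq2 hq21 k
      simp only [sq_zpow'] at ht
      have := (ht.mul_left (q ^ k / (2 * (1 - (q ^ k) ^ 2)))).add
        (((shift h0 h1 (hB h0 h1) k).add (hB h0 h1)).mul_left (S (q ^ k) / 4))
      have e : q ^ k / (2 * (1 - (q ^ k) ^ 2)) * (2 * k) + S (q ^ k) / 4 * (A (q ^ 2) + A (q ^ 2))
        = (2 * k * q ^ k / (1 - (q ^ k) ^ 2)) / 2 + S (q ^ k) / 2 * A (q ^ 2) := by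
        have := one_sub_sq_ne h0 h1 (zpow_pos h0 k) (zpow_ne_one h0 h1 hk)
        field_simp; ring
      rw [e] at this
      refine this.congr_fun ?_
      intro b
      simp only [zpow_add₀ h0.ne']
      exact (id5 h0 h1 (zpow_pos h0 b) (zpow_pos h0 k) (zpow_ne_one h0 h1 hk)))
  have h2 := ((hK h0 h1).div_const 2).add (((hA h0 h1).div_const 2).mul_right (A (q ^ 2)))
  have h4 : HasSum (fun k : ℤ => if k = 0 then T (q ^ 2) / 2 else 0) (T (q ^ 2) / 2) := hasSum_ite_eq 0 _
  have h5 := hc.unique ((h2.add h4).congr_fun (fun k => by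
    by_cases hk : k = 0
    · subst hk; simp [S]; ring
    · simp [hk]))
  have h6 := AB_eq h0 h1
  nlinarith

end
end RF

namespace RF

/-- `∑ d x^d` -/
noncomputable def f {𝕜 : Type*} [Field 𝕜] (x : 𝕜) : 𝕜 := x / (1 - x) ^ 2

lemma f_inv {𝕜 : Type*} [Field 𝕜] {x : 𝕜} (hx : x ≠ 0) (hx1 : x ≠ 1) : f x⁻¹ = f x := by
  have : 1 - x ≠ 0 := sub_ne_zero.2 (Ne.symm hx1)
  have : x - 1 ≠ 0 := sub_ne_zero.2 hx1
  unfold f; field_simp; ring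

lemma hasSum_int {𝕜 : Type*} [RCLike 𝕜] {g : ℤ → 𝕜} {s s' : 𝕜}
    (h : HasSum (fun n : ℕ => g ((n : ℤ) + 1)) s) (h' : HasSum (fun n : ℕ => g (-((n : ℤ) + 1))) s') :
    HasSum g (g 0 + s + s') := by
  refine HasSum.of_nat_of_neg_add_one (f := g) ?_ h'
  have := (hasSum_nat_add_iff (f := fun n : ℕ => g n) 1 (g := s)).1 (by simpa using h)
  simpa [add_comm] using this

lemma hasSum_int_even {𝕜 : Type*} [RCLike 𝕜] {g : ℤ → 𝕜} {s : 𝕜} (hg : ∀ m, g (-m) = g m)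
    (h : HasSum (fun n : ℕ => g ((n : ℤ) + 1)) s) : HasSum g (g 0 + 2 * s) := by
  have := hasSum_int h (by simpa only [hg] using h)
  rwa [two_mul, ← add_assoc]

lemma summable_base {q : ℝ} (h0 : 0 < q) (h1 : q < 1) (e : ℕ) :
    Summable fun p : ℕ × ℕ => ((p.2 : ℝ) + 1) ^ e * q ^ ((p.1 + 1) * (p.2 + 1)) := by
  have hg := summable_geometric_of_lt_one h0.le h1
  have hd : Summable fun d : ℕ => ((d : ℝ) + 1) ^ e * q ^ (d + 1) := by
    have := summable_pow_mul_geometric_of_norm_lt_one (R := ℝ) e (r := q) (by rwa [Real.norm_eq_abs, abs_of_pos h0])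
    have := (summable_nat_add_iff 1).2 this
    simpa using this
  have := hg.mul_of_nonneg hd (fun _ => by positivity) (fun _ => by positivity)
  refine Summable.of_nonneg_of_le (fun _ => by positivity) (fun p => ?_) this
  rw [mul_left_comm]
  gcongr
  rw [← pow_add]
  exact pow_le_pow_of_le_one h0.le h1.le (by nlinarith [Nat.zero_le (p.1 * p.2)])

lemma hasSum_f {𝕜 : Type*} [RCLike 𝕜] {x : 𝕜} (hx : ‖x‖ < 1) :
    HasSum (fun d : ℕ => ((d : 𝕜) + 1) * x ^ (d + 1)) (f x) := by
  have := hasSum_coe_mul_geometric_of_norm_lt_one hx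
  have := (hasSum_nat_add_iff' 1).2 this
  simpa [f] using this

lemma swap {q : ℝ} (h0 : 0 < q) (h1 : q < 1) {c : ℕ → ℝ} (hc : ∀ j, |c j| ≤ 1) {h : ℝ → ℝ}
    (hh : ∀ x, 0 < x → x < 1 → HasSum (fun j : ℕ => c j * x ^ (j + 1)) (h x)) :
    ∃ s, HasSum (fun j : ℕ => c j * f (q ^ (j + 1))) s ∧
      HasSum (fun d : ℕ => ((d : ℝ) + 1) * h (q ^ (d + 1))) s := by
  have hs : Summable fun p : ℕ × ℕ => c p.1 * (((p.2 : ℝ) + 1) * q ^ ((p.1 + 1) * (p.2 + 1))) := by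
    refine Summable.of_norm_bounded (summable_base h0 h1 1) fun p => ?_
    rw [norm_mul, Real.norm_eq_abs, Real.norm_eq_abs, pow_one,
      abs_of_nonneg (show 0 ≤ ((p.2 : ℝ) + 1) * q ^ ((p.1 + 1) * (p.2 + 1)) by positivity)]
    exact mul_le_of_le_one_left (by positivity) (hc _)
  refine ⟨_, hs.hasSum.prod_fiberwise fun j => ?_, ?_⟩
  · have := (hasSum_f (x := q ^ (j + 1)) (by
      rw [Real.norm_eq_abs, abs_of_pos (by positivity)]; exact pow_lt_one₀ h0.le h1 (by simp))).mul_left (c j)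
    simpa only [← pow_mul] using this
  · have h2 := (Equiv.prodComm ℕ ℕ).hasSum_iff.2 hs.hasSum
    refine h2.prod_fiberwise fun d => ?_
    have := (hh (q ^ (d + 1)) (by positivity) (pow_lt_one₀ h0.le h1 (by simp))).mul_left ((d : ℝ) + 1)
    refine this.congr_fun fun j => ?_
    simp only [Function.comp_apply, Equiv.prodComm_apply, Prod.fst_swap, Prod.snd_swap]
    rw [← pow_mul]; ring

/-- `∑ σ(n) q^n` -/
noncomputable def s (q : ℝ) : ℝ := ∑' n : ℕ, f (q ^ (n + 1))

lemma geom1 (x : ℝ) (hx0 : 0 < x) (hx1 : x < 1) :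
    HasSum (fun j : ℕ => (1 : ℝ) * x ^ (j + 1)) (x / (1 - x)) := by
  have := (hasSum_geometric_of_lt_one hx0.le hx1).mul_left x
  simpa [pow_succ', div_eq_mul_inv] using this

lemma hs1 {q : ℝ} (h0 : 0 < q) (h1 : q < 1) : HasSum (fun n : ℕ => f (q ^ (n + 1))) (s q) := by
  obtain ⟨S', hS, -⟩ := swap h0 h1 (c := fun _ => 1) (by simp) geom1
  simp only [one_mul] at hS
  exact hS.summable.hasSum

lemma hs2 {q : ℝ} (h0 : 0 < q) (h1 : q < 1) :
    HasSum (fun d : ℕ => ((d : ℝ) + 1) * (q ^ (d + 1) / (1 - q ^ (d + 1)))) (s q) := by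
  obtain ⟨S', hS, hS2⟩ := swap h0 h1 (c := fun _ => 1) (by simp) geom1
  simp only [one_mul] at hS
  rwa [← hS.tsum_eq] at hS2

section
variable {q : ℝ} (h0 : 0 < q) (h1 : q < 1)
include h0 h1

lemma T_eq : T q = 1 + 8 * (s (q ^ 2) - 4 * s (q ^ 4)) := by
  have h2 := hs1 (pow_pos h0 2) (pow_lt_one₀ h0.le h1 two_ne_zero)
  have h4 := hs1 (pow_pos h0 4) (pow_lt_one₀ h0.le h1 four_ne_zero)
  have h5 := (h2.sub (h4.mul_left 4)).mul_left 4
  have h6 := hasSum_int_even (𝕜 := ℝ) (g := fun m : ℤ => S (q ^ m) ^ 2)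
    (s := 4 * (s (q ^ 2) - 4 * s (q ^ 4)))
    (fun m => by simp only [zpow_neg, S_inv (zpow_pos h0 m)])
    (h5.congr_fun fun n => by
      have e : q ^ ((n : ℤ) + 1) = q ^ (n + 1) := by norm_cast
      simp only [e]
      rw [pow_right_comm q 2, pow_right_comm q 4]
      have hu : 0 < q ^ (n + 1) := by positivity
      have hu1 : q ^ (n + 1) < 1 := pow_lt_one₀ h0.le h1 (by simp)
      set u := q ^ (n + 1)
      have e1 : 1 - u ^ 2 ≠ 0 := by nlinarith
      have e2 : 1 - u ^ 4 ≠ 0 := by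
        have : 1 - u ^ 4 = (1 - u ^ 2) * (1 + u ^ 2) := by ring
        rw [this]; positivity
      have e3 : f (u ^ 4) = u ^ 4 / ((1 - u ^ 2) * (1 + u ^ 2)) ^ 2 := by
        unfold f; congr 1; ring
      rw [e3]
      unfold S f
      field_simp
      ring)
  have := (hT h0 h1).unique h6
  rw [this]; simp [S]; norm_num; ring

lemma K_eq : K q = 4 * (s q - s (q ^ 2)) := by
  have h2 := hs2 (pow_pos h0 2) (pow_lt_one₀ h0.le h1 two_ne_zero)
  have h5 := ((hs2 h0 h1).sub h2).mul_left 2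
  have h6 := hasSum_int_even (𝕜 := ℝ) (g := fun k : ℤ => 2 * k * q ^ k / (1 - (q ^ k) ^ 2))
    (s := 2 * (s q - s (q ^ 2)))
    (fun m => by
      by_cases hm : m = 0
      · subst hm; simp
      have h3 := zpow_pos h0 m
      have h4 := one_sub_sq_ne h0 h1 h3 (zpow_ne_one h0 h1 hm)
      have h5 : (q ^ m) ^ 2 - 1 ≠ 0 := by
        intro h; apply h4; linarith
      simp only [zpow_neg, Int.cast_neg]
      field_simp
      ring)
    (h5.congr_fun fun n => by
      have e : q ^ ((n : ℤ) + 1) = q ^ (n + 1) := by norm_cast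
      simp only [e]
      rw [pow_right_comm q 2]
      have hu : 0 < q ^ (n + 1) := by positivity
      have hu1 : q ^ (n + 1) < 1 := pow_lt_one₀ h0.le h1 (by simp)
      push_cast
      set u := q ^ (n + 1)
      have e1 : 1 - u ≠ 0 := by linarith
      have e2 : 1 - u ^ 2 = (1 - u) * (1 + u) := by ring
      have e3 : 1 + u ≠ 0 := by positivity
      rw [e2]
      field_simp
      ring)
  have := (hK h0 h1).unique h6
  rw [this]; simp; ring

end

/-- the character -/
def chi (n : ℕ) : ℤ := ZMod.χ₈ (n : ZMod 8)

lemma chi_add (n : ℕ) : chi (n + 8) = chi n := by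
  unfold chi
  have : ((n + 8 : ℕ) : ZMod 8) = n := by
    push_cast
    have : (8 : ZMod 8) = 0 := by decide
    rw [this, add_zero]
  rw [this]

lemma chi_abs (n : ℕ) : |(chi n : ℝ)| ≤ 1 := by
  have : ∀ a : ZMod 8, |ZMod.χ₈ a| ≤ 1 := by decide
  have := this n
  unfold chi
  exact_mod_cast this

lemma hasSum_chi (x : ℝ) (hx0 : 0 < x) (hx1 : x < 1) :
    HasSum (fun j : ℕ => (chi (j + 1) : ℝ) * x ^ (j + 1)) (H x) := by
  have hs : Summable fun j : ℕ => (chi j : ℝ) * x ^ j := by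
    refine Summable.of_norm_bounded (summable_geometric_of_lt_one hx0.le hx1) fun j => ?_
    rw [norm_mul, Real.norm_eq_abs, Real.norm_eq_abs, abs_of_pos (pow_pos hx0 j)]
    exact mul_le_of_le_one_left (by positivity) (chi_abs _)
  have h8 := hs.sum_add_tsum_nat_add 8
  have e : ∑' i : ℕ, (chi (i + 8) : ℝ) * x ^ (i + 8) = x ^ 8 * ∑' i : ℕ, (chi i : ℝ) * x ^ i := by
    rw [← tsum_mul_left]
    refine tsum_congr fun i => ?_
    rw [chi_add]; ring
  rw [e] at h8
  have e0 : chi 0 = 0 := by decide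
  have e1 : chi 1 = 1 := by decide
  have e2 : chi 2 = 0 := by decide
  have e3 : chi 3 = -1 := by decide
  have e4 : chi 4 = 0 := by decide
  have e5 : chi 5 = -1 := by decide
  have e6 : chi 6 = 0 := by decide
  have e7 : chi 7 = 1 := by decide
  simp only [Finset.sum_range_succ, Finset.sum_range_zero, e0, e1, e2, e3, e4, e5, e6, e7] at h8
  have h9 : ∑' i : ℕ, (chi i : ℝ) * x ^ i = H x := by
    unfold H
    rw [eq_div_iff (by positivity)]
    have h10 : 1 - x ^ 4 ≠ 0 := by
      have := pow_lt_one₀ hx0.le hx1 four_ne_zero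
      linarith
    apply mul_left_cancel₀ h10
    push_cast at h8
    linear_combination -h8
  have h11 := hs.hasSum
  rw [h9] at h11
  have := (hasSum_nat_add_iff' 1).2 h11
  simpa [e0] using this

/-- `∑_j χ(j) f(q^j)` -/
lemma D1_eq {q : ℝ} (h0 : 0 < q) (h1 : q < 1) :
    HasSum (fun j : ℕ => (chi (j + 1) : ℝ) * f (q ^ (j + 1))) (L q * (A q - A (q ^ 2)) / 4) := by
  obtain ⟨s', hs, hs'⟩ := swap h0 h1 (c := fun j => (chi (j + 1) : ℝ)) (fun j => chi_abs _) hasSum_chi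
  have h6 := hasSum_int_even (𝕜 := ℝ) (g := fun k : ℤ => 2 * k * H (q ^ k))
    (s := 2 * s')
    (fun m => by
      simp only [zpow_neg, Int.cast_neg, H_inv (zpow_pos h0 m)]
      ring)
    ((hs'.mul_left 2).congr_fun fun n => by
      have e : q ^ ((n : ℤ) + 1) = q ^ (n + 1) := by norm_cast
      rw [e]; push_cast; ring)
  have := (LA_eq h0 h1).unique h6
  have e : s' = L q * (A q - A (q ^ 2)) / 4 := by
    simp at this
    linarith
  rwa [← e]

end RF

namespace RF

/-- `φ(q)` -/
noncomputable def th (q : ℝ) : ℝ := ∑' m : ℤ, q ^ (m ^ 2)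
/-- `φ(-q)` -/
noncomputable def thn (q : ℝ) : ℝ := ∑' m : ℤ, (-1) ^ m * q ^ (m ^ 2)

lemma sq_lt1 {q : ℝ} (h0 : 0 < q) (h1 : q < 1) : 0 < q ^ 2 ∧ q ^ 2 < 1 :=
  ⟨pow_pos h0 2, pow_lt_one₀ h0.le h1 two_ne_zero⟩

section
variable {q : ℝ} (h0 : 0 < q) (h1 : q < 1)
include h0 h1

lemma zpow_sq_le (m : ℤ) : q ^ (m ^ 2) ≤ q ^ m.natAbs := by
  have : m ^ 2 = ((m.natAbs ^ 2 : ℕ) : ℤ) := by simp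
  rw [this, zpow_natCast]
  exact pow_le_pow_of_le_one h0.le h1.le (by nlinarith [Nat.zero_le m.natAbs, Nat.le_mul_self m.natAbs])

lemma summable_th : Summable fun m : ℤ => q ^ (m ^ 2) :=
  Summable.of_nonneg_of_le (fun _ => (zpow_pos h0 _).le) (zpow_sq_le h0 h1) (summable_q_abs h0 h1)

lemma hth : HasSum (fun m : ℤ => q ^ (m ^ 2)) (th q) := (summable_th h0 h1).hasSum
lemma hthn : HasSum (fun m : ℤ => (-1) ^ m * q ^ (m ^ 2)) (thn q) :=
  (summable_sign (summable_th h0 h1)).hasSum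

lemma R1 : th q + thn q = 2 * th (q ^ 4) := by
  have := even_part h0 h1 (summable_th h0 h1)
  unfold th thn
  rw [this]
  congr 1
  refine tsum_congr fun m => ?_
  rw [← zpow_natCast q 4, ← zpow_mul]
  congr 1; push_cast; ring

lemma th_sq_eq : HasSum (fun p : ℤ × ℤ => q ^ (p.1 ^ 2 + p.2 ^ 2)) (th q ^ 2) := by
  have h := (hth h0 h1)
  have := h.mul h (h.summable.mul_of_nonneg h.summable (fun _ => (zpow_pos h0 _).le)
    (fun _ => (zpow_pos h0 _).le))
  rw [pow_two]
  refine this.congr_fun fun p => ?_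
  rw [zpow_add₀ h0.ne']

lemma R2 : th q ^ 2 + thn q ^ 2 = 2 * th (q ^ 2) ^ 2 := by
  obtain ⟨g0, g1⟩ := sq_lt1 h0 h1
  have h := hthn h0 h1
  have hn := summable_mul_of_summable_norm h.summable.norm h.summable.norm
  have hn := h.mul h hn
  have hs := (th_sq_eq h0 h1).add hn
  have hy := (th_sq_eq g0 g1).mul_left 2
  rw [← pow_two] at hs
  refine hs.unique ?_
  have hinj : Function.Injective (fun p : ℤ × ℤ => (p.1 + p.2, p.1 - p.2)) := by
    rintro ⟨a, b⟩ ⟨c, d⟩ h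
    simp only [Prod.mk.injEq] at h ⊢
    omega
  refine (hinj.hasSum_iff ?_).1 (hy.congr_fun ?_)
  · rintro ⟨m, n⟩ hmn
    have hodd : Odd (m + n) := by
      by_contra hc
      rw [Int.not_odd_iff_even] at hc
      obtain ⟨r, hr⟩ := hc
      apply hmn
      refine ⟨(r, m - r), ?_⟩
      simp only [Prod.mk.injEq]
      omega
    have e : ((-1 : ℝ)) ^ m * (-1) ^ n = -1 := by
      rw [← zpow_add₀ (by norm_num), hodd.neg_one_zpow]
    rw [zpow_add₀ h0.ne']
    linear_combination q ^ m ^ 2 * q ^ n ^ 2 * e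
  · rintro ⟨u, v⟩
    simp only [Function.comp_apply]
    have e : ((-1 : ℝ)) ^ (u + v) * (-1) ^ (u - v) = 1 := by
      rw [← zpow_add₀ (by norm_num)]
      have : Even (u + v + (u - v)) := ⟨u, by ring⟩
      rw [this.neg_one_zpow]
    have e2 : (q ^ 2) ^ (u ^ 2 + v ^ 2) = q ^ (u + v) ^ 2 * q ^ (u - v) ^ 2 := by
      rw [← zpow_add₀ h0.ne', ← zpow_natCast q 2, ← zpow_mul]
      congr 1; push_cast; ring
    rw [zpow_add₀ h0.ne', e2]
    linear_combination (q ^ (u + v) ^ 2 * q ^ (u - v) ^ 2) * e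

/-- the conic -/
lemma conic : th (q ^ 2) ^ 2 = 2 * th (q ^ 4) ^ 2 - 2 * th (q ^ 4) * th q + th q ^ 2 := by
  have a := R1 h0 h1
  have b := R2 h0 h1
  have c : thn q = 2 * th (q ^ 4) - th q := by linarith
  rw [c] at b
  linarith

lemma th_lt : th (q ^ 2) < th q := by
  obtain ⟨g0, g1⟩ := sq_lt1 h0 h1
  refine hasSum_lt (i := (1 : ℤ)) (fun m => ?_) ?_ (hth g0 g1) (hth h0 h1)
  · have e : m ^ 2 = ((m.natAbs ^ 2 : ℕ) : ℤ) := by simp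
    simp only [e, zpow_natCast]
    exact pow_le_pow_left₀ g0.le (by nlinarith) _
  · simp; nlinarith

lemma th_lower : 1 + 2 * q ≤ th q := by
  have := (summable_th h0 h1).sum_le_tsum {0, 1, -1} (fun _ _ => (zpow_pos h0 _).le)
  simp at this
  unfold th; linarith

lemma geo : HasSum (fun m : ℕ => q ^ (m + 1)) (q / (1 - q)) := by
  simpa using geom1 q h0 h1

lemma geoZ : HasSum (fun m : ℤ => q ^ m.natAbs) (1 + 2 * (q / (1 - q))) := by
  have := hasSum_int_even (𝕜 := ℝ) (g := fun m : ℤ => q ^ m.natAbs) (s := q / (1 - q))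
    (by simp) ((geo h0 h1).congr_fun fun n => by
      congr 1)
  simpa using this

lemma th_upper : th q ≤ 1 + 2 * (q / (1 - q)) :=
  hasSum_le (zpow_sq_le h0 h1) (hth h0 h1) (geoZ h0 h1)

lemma A_lower : 1 + 4 * q / (1 + q ^ 2) ≤ A q := by
  have := (summable_S h0 h1).sum_le_tsum {0, 1, -1} (fun m _ => (S_pos (zpow_pos h0 m)).le)
  simp at this
  rw [S_inv h0] at this
  have e : S 1 = 1 := by unfold S; norm_num
  have e2 : 1 + 4 * q / (1 + q ^ 2) = 1 + (S q + S q) := by unfold S; ring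
  rw [e2]
  unfold A; linarith

lemma A_upper : A q ≤ 1 + 4 * (q / (1 - q)) := by
  have := hasSum_int_even (𝕜 := ℝ) (g := fun m : ℤ => S (q ^ m)) (s := ∑' n : ℕ, S (q ^ ((n : ℤ) + 1)))
    (fun m => by simp only [zpow_neg, S_inv (zpow_pos h0 m)])
    (Summable.hasSum (((summable_S h0 h1)).comp_injective (i := fun n : ℕ => (n : ℤ) + 1)
      (fun a b h => by simpa using h)))
  rw [(hA h0 h1).unique this]
  have h2 : ∑' n : ℕ, S (q ^ ((n : ℤ) + 1)) ≤ 2 * (q / (1 - q)) := by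
    refine hasSum_le (f := fun n : ℕ => S (q ^ ((n : ℤ) + 1))) (fun n => ?_) (Summable.hasSum (((summable_S h0 h1)).comp_injective (i := fun n : ℕ => (n : ℤ) + 1)
      (fun a b h => by simpa using h))) ((geo h0 h1).mul_left 2)
    have e : q ^ ((n : ℤ) + 1) = q ^ (n + 1) := by norm_cast
    simp only [e]
    exact (le_abs_self _).trans (S_le (by positivity))
  simp [S] at *
  linarith

lemma A_lt : A (q ^ 2) < A q := by
  have key : ∀ u : ℝ, 0 < u → S u - S (u ^ 2) = 2 * u * ((1 - u) ^ 2 * (1 + u + u ^ 2)) / ((1 + u ^ 2) * (1 + u ^ 4)) := by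
    intro u hu; unfold S; field_simp; ring
  refine hasSum_lt (i := (1 : ℤ)) (fun m => ?_) ?_ (hB h0 h1) (hA h0 h1)
  · have hm := zpow_pos h0 m
    have := key _ hm
    have h2 : 0 ≤ S (q ^ m) - S ((q ^ m) ^ 2) := by rw [this]; positivity
    linarith
  · have := key _ h0
    simp only [zpow_one]
    have h3 : 0 < 1 - q := by linarith
    have h2 : 0 < S q - S (q ^ 2) := by rw [this]; positivity
    linarith

lemma A_pos : 0 < A q := by
  have := A_lower h0 h1
  have : 0 ≤ 4 * q / (1 + q ^ 2) := by positivity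
  linarith
lemma th_pos : 0 < th q := by have := th_lower h0 h1; linarith
lemma L_pos : 0 < L q := by
  have := (summable_C h0 h1).sum_le_tsum {0} (fun m _ => (C_pos (zpow_pos h0 m)).le)
  simp at this
  have e : C 1 = 1 := by unfold C; norm_num
  unfold L; linarith

lemma A_le : A q ≤ 2 * A (q ^ 2) := by
  obtain ⟨g0, g1⟩ := sq_lt1 h0 h1
  have a := AnB_eq h0 h1
  have b := A_add_An h0 h1
  have c := A_pos g0 g1
  have : 0 ≤ An q := by
    by_contra hc
    push Not at hc
    nlinarith [sq_nonneg (Ln q)]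
  linarith

lemma A_rel : (A q - A (q ^ 2)) ^ 2 = 4 * A (q ^ 4) * (A (q ^ 2) - A (q ^ 4)) := by
  obtain ⟨g0, g1⟩ := sq_lt1 h0 h1
  have e1 := AB_eq h0 h1
  have e2 := AnB_eq h0 h1
  have e3 := A_add_An h0 h1
  have e4 := L_add_Ln h0 h1
  have e5 := AB_eq g0 g1
  have c := A_pos g0 g1
  rw [← pow_mul] at e5
  norm_num at e5
  have e6 : An q = 2 * A (q ^ 2) - A q := by linarith
  have e7 : Ln q = 2 * L (q ^ 2) - L q := by linarith
  rw [e6, e7] at e2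
  generalize A q = a at *
  generalize A (q ^ 2) = b at *
  generalize A (q ^ 4) = d at *
  generalize L q = l at *
  generalize L (q ^ 2) = m at *
  have h1 : b * (a - b + 2 * d) = 2 * l * m := by linear_combination (-1/2) * e2 + (1/2) * e1 + 2 * e5
  have h2 : b ^ 2 * ((a - b) ^ 2 - 4 * d * (b - d)) = 0 := by
    linear_combination (b * (a - b + 2 * d) + 2 * l * m) * h1 - 4 * m ^ 2 * e1 - 4 * a * b * e5
  rcases mul_eq_zero.1 h2 with h | h
  · exact absurd h (by positivity)
  · linarith

end

/-- hypotheses for uniqueness -/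
def Good (a : ℝ → ℝ) : Prop :=
  (∀ q, 0 < q → q < 1 → 0 < a q ∧ a q ≤ 1 ∧ a q ^ 2 * (1 + a (q ^ 2)) ^ 2 = 4 * a (q ^ 2)) ∧
  ∀ q, 0 < q → q ≤ 1 / 4 → q / 2 ≤ a q ∧ a q ≤ 16 * q

lemma good_A : Good fun q => A q / A (q ^ 2) - 1 := by
  refine ⟨fun q h0 h1 => ?_, fun q h0 h14 => ?_⟩
  · obtain ⟨g0, g1⟩ := sq_lt1 h0 h1
    obtain ⟨k0, k1⟩ := sq_lt1 g0 g1
    have e : (q ^ 2) ^ 2 = q ^ 4 := by ring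
    simp only [e] at *
    have a := A_lt h0 h1
    have b := A_le h0 h1
    have c := A_pos g0 g1
    have c4 := A_pos k0 k1
    refine ⟨?_, ?_, ?_⟩
    · rw [sub_pos, one_lt_div c]; exact a
    · rw [sub_le_iff_le_add, div_le_iff₀ c]; linarith
    · have := A_rel h0 h1
      field_simp
      linear_combination A (q ^ 2) ^ 2 * this
  · have h1 : q < 1 := by linarith
    obtain ⟨g0, g1⟩ := sq_lt1 h0 h1
    have a := A_lower h0 h1
    have b := A_upper h0 h1
    have a2 := A_lower g0 g1
    have b2 := A_upper g0 g1
    have c := A_pos g0 g1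
    have d1 : 3 * q ≤ 4 * q / (1 + q ^ 2) := by rw [le_div_iff₀ (by positivity)]; nlinarith
    have d2 : q / (1 - q) ≤ 2 * q := by rw [div_le_iff₀ (by linarith)]; nlinarith
    have d5 : q ^ 2 ≤ 1 / 16 := by nlinarith
    have d3 : q ^ 2 / (1 - q ^ 2) ≤ (5/4) * q ^ 2 := by rw [div_le_iff₀ (by linarith)]; nlinarith
    have d4 : 0 ≤ 4 * q ^ 2 / (1 + (q ^ 2) ^ 2) := by positivity
    constructor
    · rw [le_sub_iff_add_le, le_div_iff₀ c]
      have : A (q ^ 2) ≤ 3/2 := by nlinarith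
      nlinarith
    · rw [sub_le_iff_le_add, div_le_iff₀ c]
      nlinarith

lemma good_th : Good fun q => th q ^ 2 / th (q ^ 2) ^ 2 - 1 := by
  refine ⟨fun q h0 h1 => ?_, fun q h0 h14 => ?_⟩
  · obtain ⟨g0, g1⟩ := sq_lt1 h0 h1
    obtain ⟨k0, k1⟩ := sq_lt1 g0 g1
    have e : (q ^ 2) ^ 2 = q ^ 4 := by ring
    simp only [e] at *
    have a := th_lt h0 h1
    have c := th_pos g0 g1
    have c4 := th_pos k0 k1
    have d := R2 h0 h1
    have f := conic h0 h1
    have c2 : 0 < th (q ^ 2) ^ 2 := by positivity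
    refine ⟨?_, ?_, ?_⟩
    · rw [sub_pos, one_lt_div c2]; nlinarith
    · rw [sub_le_iff_le_add, div_le_iff₀ c2]; nlinarith [sq_nonneg (thn q)]
    · have e0 : th q ^ 2 - th (q ^ 2) ^ 2 = 2 * th (q ^ 4) * (th q - th (q ^ 4)) := by
        linear_combination -f
      have : (th q ^ 2 - th (q ^ 2) ^ 2) ^ 2 = 4 * th (q ^ 4) ^ 2 * (th (q ^ 2) ^ 2 - th (q ^ 4) ^ 2) := by
        rw [e0, f]; ring
      field_simp
      linear_combination th (q ^ 2) ^ 4 * this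
  · have h1 : q < 1 := by linarith
    obtain ⟨g0, g1⟩ := sq_lt1 h0 h1
    have a := th_lower h0 h1
    have b := th_upper h0 h1
    have a2 := th_lower g0 g1
    have b2 := th_upper g0 g1
    have c := th_pos g0 g1
    have d2 : q / (1 - q) ≤ 2 * q := by rw [div_le_iff₀ (by linarith)]; nlinarith
    have d5 : q ^ 2 ≤ 1 / 16 := by nlinarith
    have d3 : q ^ 2 / (1 - q ^ 2) ≤ (5/4) * q ^ 2 := by rw [div_le_iff₀ (by linarith)]; nlinarith
    have c2 : 0 < th (q ^ 2) ^ 2 := by positivity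
    constructor
    · rw [le_sub_iff_add_le, le_div_iff₀ c2]
      have u1 : th (q ^ 2) ≤ 1 + q := by nlinarith
      have u2 : th (q ^ 2) ^ 2 ≤ (1 + q) ^ 2 := pow_le_pow_left₀ c.le u1 2
      have u3 : th (q ^ 2) ^ 2 ≤ (1 + 5/2 * q ^ 2) ^ 2 := pow_le_pow_left₀ c.le (by linarith) 2
      have u4 : (1 + 2 * q) ^ 2 ≤ th q ^ 2 := pow_le_pow_left₀ (by positivity) a 2
      nlinarith
    · rw [sub_le_iff_le_add, div_le_iff₀ c2]
      have u4 : th q ^ 2 ≤ (1 + 4 * q) ^ 2 := pow_le_pow_left₀ (by linarith) (by linarith) 2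
      have u5 : 1 ≤ th (q ^ 2) ^ 2 := by nlinarith
      nlinarith

lemma pow_two_lt {q : ℝ} (h0 : 0 < q) (h1 : q < 1) (n : ℕ) : 0 < q ^ (2 ^ n) ∧ q ^ (2 ^ n) < 1 :=
  ⟨pow_pos h0 _, pow_lt_one₀ h0.le h1 (by positivity)⟩

lemma tendsto_pp {q : ℝ} (h0 : 0 < q) (h1 : q < 1) :
    Filter.Tendsto (fun n : ℕ => q ^ (2 ^ n)) Filter.atTop (nhds 0) :=
  (tendsto_pow_atTop_nhds_zero_of_lt_one h0.le h1).comp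
    (tendsto_pow_atTop_atTop_of_one_lt one_lt_two)

lemma uniq_le {a b : ℝ → ℝ} (ha : Good a) (hb : Good b) {q : ℝ} (h0 : 0 < q) (h1 : q < 1) : a q ≤ b q := by
  by_contra hc
  push Not at hc
  have hb0 := (hb.1 q h0 h1).1
  set r := a q / b q with hr
  have hr1 : 1 < r := by rw [hr, one_lt_div hb0]; exact hc
  have key : ∀ n : ℕ, r ^ (2 ^ n) * b (q ^ (2 ^ n)) ≤ a (q ^ (2 ^ n)) := by
    intro n
    induction n with
    | zero => simp [hr, div_mul_cancel₀ _ hb0.ne']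
    | succ n ih =>
      obtain ⟨g0, g1⟩ := pow_two_lt h0 h1 n
      have e : q ^ (2 ^ (n + 1)) = (q ^ (2 ^ n)) ^ 2 := by rw [pow_succ, pow_mul]
      have e' : r ^ (2 ^ (n + 1)) = (r ^ (2 ^ n)) ^ 2 := by rw [pow_succ, pow_mul]
      rw [e, e']
      have hR : 1 ≤ r ^ (2 ^ n) := one_le_pow₀ hr1.le
      generalize r ^ (2 ^ n) = R at *
      generalize q ^ (2 ^ n) = Q at *
      obtain ⟨k0, k1⟩ := sq_lt1 g0 g1
      obtain ⟨a1, a2, a3⟩ := ha.1 Q g0 g1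
      obtain ⟨b1, b2, b3⟩ := hb.1 Q g0 g1
      obtain ⟨a4, a5, -⟩ := ha.1 _ k0 k1
      obtain ⟨b4, b5, -⟩ := hb.1 _ k0 k1
      generalize a (Q ^ 2) = A1 at *
      generalize b (Q ^ 2) = B1 at *
      generalize a Q = A0 at *
      generalize b Q = B0 at *
      have i1 : (R * B0) ^ 2 ≤ A0 ^ 2 := pow_le_pow_left₀ (by positivity) ih 2
      have i2 : R ^ 2 * (4 * B1) * (1 + A1) ^ 2 ≤ 4 * A1 * (1 + B1) ^ 2 := by
        rw [← a3, ← b3]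
        have := mul_le_mul_of_nonneg_right i1 (show 0 ≤ ((1 + A1) * (1 + B1)) ^ 2 by positivity)
        nlinarith
      have hR2 : 1 ≤ R ^ 2 := one_le_pow₀ hR
      have i3 : B1 ≤ A1 := by
        by_contra hh
        push Not at hh
        have : (4 * B1) * (1 + A1) ^ 2 ≤ 4 * A1 * (1 + B1) ^ 2 := by
          refine le_trans ?_ i2
          have : 0 ≤ (4 * B1) * (1 + A1) ^ 2 := by positivity
          nlinarith
        have : (B1 - A1) * (1 - A1 * B1) ≤ 0 := by nlinarith
        have h5 : 0 < 1 - A1 * B1 := by nlinarith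
        nlinarith [mul_pos (sub_pos.2 hh) h5]
      have i4 : (1 + B1) ^ 2 ≤ (1 + A1) ^ 2 := pow_le_pow_left₀ (by positivity) (by linarith) 2
      have i5 : R ^ 2 * (4 * B1) * (1 + A1) ^ 2 ≤ 4 * A1 * (1 + A1) ^ 2 :=
        i2.trans (by gcongr)
      have := le_of_mul_le_mul_right i5 (by positivity)
      linarith
  have t1 := tendsto_pp h0 h1
  have t2 : Filter.Tendsto (fun n : ℕ => r ^ (2 ^ n)) Filter.atTop Filter.atTop :=
    (tendsto_pow_atTop_atTop_of_one_lt hr1).comp (tendsto_pow_atTop_atTop_of_one_lt one_lt_two)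
  have v1 := t1.eventually (ge_mem_nhds (show (0 : ℝ) < 1 / 4 by norm_num))
  have v2 := t2.eventually (Filter.eventually_gt_atTop 32)
  obtain ⟨n, w1, w2⟩ := (v1.and v2).exists
  have k := key n
  obtain ⟨g0, g1⟩ := pow_two_lt h0 h1 n
  have c1 := (ha.2 _ g0 w1).2
  have c2 := (hb.2 _ g0 w1).1
  nlinarith [mul_le_mul_of_nonneg_left c2 (show 0 ≤ r ^ (2 ^ n) by linarith)]

/-- `A = φ²` -/
theorem A_eq_th_sq {q : ℝ} (h0 : 0 < q) (h1 : q < 1) : A q = th q ^ 2 := by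
  have hv : ∀ q, 0 < q → q < 1 → A q / th q ^ 2 = A (q ^ 2) / th (q ^ 2) ^ 2 := by
    intro q h0 h1
    obtain ⟨g0, g1⟩ := sq_lt1 h0 h1
    have e := le_antisymm (uniq_le good_A good_th h0 h1) (uniq_le good_th good_A h0 h1)
    have a1 := A_pos g0 g1
    have a2 := th_pos g0 g1
    have a3 := th_pos h0 h1
    have e2 : A q / A (q ^ 2) = th q ^ 2 / th (q ^ 2) ^ 2 := by linarith
    rw [div_eq_div_iff (by positivity) (by positivity)] at e2 ⊢
    linarith
  have hn : ∀ n : ℕ, A q / th q ^ 2 = A (q ^ (2 ^ n)) / th (q ^ (2 ^ n)) ^ 2 := by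
    intro n
    induction n with
    | zero => simp
    | succ n ih =>
      obtain ⟨g0, g1⟩ := pow_two_lt h0 h1 n
      have e : q ^ (2 ^ (n + 1)) = (q ^ (2 ^ n)) ^ 2 := by rw [pow_succ, pow_mul]
      rw [ih, hv _ g0 g1, e]
  have hb : ∀ᶠ n : ℕ in Filter.atTop, |A q / th q ^ 2 - 1| ≤ 16 * q ^ (2 ^ n) := by
    filter_upwards [(tendsto_pp h0 h1).eventually (ge_mem_nhds (show (0 : ℝ) < 1 / 4 by norm_num))] with n w
    rw [hn n]
    obtain ⟨g0, g1⟩ := pow_two_lt h0 h1 n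
    generalize q ^ (2 ^ n) = Q at *
    have a := A_lower g0 g1
    have b := A_upper g0 g1
    have a2 := th_lower g0 g1
    have b2 := th_upper g0 g1
    have c := th_pos g0 g1
    have d0 : 0 ≤ 4 * Q / (1 + Q ^ 2) := by positivity
    have d2 : Q / (1 - Q) ≤ 2 * Q := by rw [div_le_iff₀ (by linarith)]; nlinarith
    have c2 : 0 < th Q ^ 2 := by positivity
    have u4 : th Q ^ 2 ≤ (1 + 4 * Q) ^ 2 := pow_le_pow_left₀ (by linarith) (by linarith) 2
    have u5 : 1 ≤ th Q ^ 2 := by nlinarith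
    rw [abs_le]
    constructor
    · rw [le_sub_iff_add_le, le_div_iff₀ c2]; nlinarith
    · rw [sub_le_iff_le_add, div_le_iff₀ c2]; nlinarith
  have t := ((tendsto_pp h0 h1).const_mul 16)
  rw [mul_zero] at t
  have := ge_of_tendsto t hb
  have h3 := abs_nonpos_iff.1 this
  have c := th_pos h0 h1
  have h4 : A q / th q ^ 2 = 1 := by linarith
  rwa [div_eq_one_iff_eq (by positivity)] at h4

theorem L_eq_th {q : ℝ} (h0 : 0 < q) (h1 : q < 1) : L q = th q * th (q ^ 2) := by
  obtain ⟨g0, g1⟩ := sq_lt1 h0 h1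
  have e := AB_eq h0 h1
  rw [A_eq_th_sq h0 h1, A_eq_th_sq g0 g1, ← mul_pow] at e
  have a := th_pos h0 h1
  have b := th_pos g0 g1
  exact (pow_left_inj₀ (by positivity) (L_pos h0 h1).le two_ne_zero).1 e |>.symm

end RF

namespace RF

section
variable {𝕜 : Type*} [RCLike 𝕜]

lemma f_bound {Y : 𝕜} (h : ‖Y‖ ≤ 1 / 2) : ‖f Y‖ ≤ 4 * ‖Y‖ := by
  unfold f
  rw [norm_div, norm_pow]
  have h1 : 1 / 2 ≤ ‖1 - Y‖ := by
    have := norm_sub_norm_le (1 : 𝕜) Y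
    rw [norm_one] at this
    linarith
  rw [div_le_iff₀ (by positivity)]
  have : (1 / 2) ^ 2 ≤ ‖1 - Y‖ ^ 2 := pow_le_pow_left₀ (by norm_num) h1 2
  nlinarith [norm_nonneg Y]

lemma summable_half {Q : 𝕜} (h1 : ‖Q‖ < 1) (Z : 𝕜) : Summable fun n : ℕ => f (Q ^ n * Z) := by
  have hg := (summable_geometric_of_lt_one (norm_nonneg Q) h1).mul_right (4 * ‖Z‖)
  refine Summable.of_norm_bounded_eventually_nat hg ?_
  have ht : Filter.Tendsto (fun n : ℕ => ‖Q‖ ^ n * ‖Z‖) Filter.atTop (nhds 0) := by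
    have := (tendsto_pow_atTop_nhds_zero_of_lt_one (norm_nonneg Q) h1).mul_const ‖Z‖
    simpa using this
  filter_upwards [ht.eventually (ge_mem_nhds (show (0 : ℝ) < 1 / 2 by norm_num))] with n hn
  have : ‖Q ^ n * Z‖ = ‖Q‖ ^ n * ‖Z‖ := by rw [norm_mul, norm_pow]
  have h2 := f_bound (Y := Q ^ n * Z) (by rw [this]; exact hn)
  rw [this] at h2
  linarith

lemma summable_f {Q X : 𝕜} (hQ : Q ≠ 0) (h1 : ‖Q‖ < 1) (hX : X ≠ 0) (hne : ∀ m : ℤ, Q ^ m * X ≠ 1) :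
    Summable fun m : ℤ => f (Q ^ m * X) := by
  refine Summable.of_nat_of_neg ?_ ?_
  · simpa using summable_half h1 X
  · refine (summable_half h1 X⁻¹).congr fun n => ?_
    rw [← f_inv (x := Q ^ (-(n : ℤ)) * X) (mul_ne_zero (zpow_ne_zero _ hQ) hX) (hne _)]
    congr 1
    rw [mul_inv, zpow_neg, inv_inv, zpow_natCast]

lemma summable_shift_mul {g : ℤ → 𝕜} (hg : Summable g) (k : ℤ) : Summable fun b => g (b + k) * g b :=
  (summable_mul_of_summable_norm hg.norm hg.norm).comp_injective (i := fun b : ℤ => (b + k, b))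
    (fun a b h => by simpa using h)

lemma f_mul {X r : 𝕜} (hr : r ≠ 1) (hX : X ≠ 1) (hrX : r * X ≠ 1) :
    f (r * X) * f X = f r * (f (r * X) + f X) +
      r * (1 + r) / (1 - r) ^ 3 * (1 / (1 - r * X) - 1 / (1 - X)) := by
  have a : 1 - r ≠ 0 := sub_ne_zero.2 (Ne.symm hr)
  have b : 1 - X ≠ 0 := sub_ne_zero.2 (Ne.symm hX)
  have c : 1 - r * X ≠ 0 := sub_ne_zero.2 (Ne.symm hrX)
  unfold f
  field_simp
  ring

lemma norm_zpow_ne {Q : 𝕜} (hQ : Q ≠ 0) (h1 : ‖Q‖ < 1) {k : ℤ} (hk : k ≠ 0) : Q ^ k ≠ 1 := by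
  intro h
  have h2 := congrArg norm h
  rw [norm_zpow, norm_one] at h2
  exact zpow_ne_one (norm_pos_iff.2 hQ) h1 hk h2

lemma e_telescope {Q X : 𝕜} (hQ : Q ≠ 0) (h1 : ‖Q‖ < 1) (hX : X ≠ 0) (hne : ∀ m : ℤ, Q ^ m * X ≠ 1) (k : ℤ) :
    HasSum (fun b : ℤ => 1 / (1 - Q ^ (b + k) * X) - 1 / (1 - Q ^ b * X)) k := by
  have hs := summable_f hQ h1 hX hne
  have hsum : Summable (fun b : ℤ => 1 / (1 - Q ^ (b + 1) * X) - 1 / (1 - Q ^ b * X)) := by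
    have e1 := summable_shift_mul hs 1
    have e2 := ((hs.comp_injective (add_left_injective 1)).add hs).mul_left (f Q)
    have e3 := (e1.sub e2).mul_left (Q * (1 + Q) / (1 - Q) ^ 3)⁻¹
    refine e3.congr fun b => ?_
    have hQ1 : Q ≠ 1 := by simpa using norm_zpow_ne hQ h1 (k := 1) one_ne_zero
    have e : Q ^ (b + 1) * X = Q * (Q ^ b * X) := by rw [zpow_add₀ hQ, zpow_one]; ring
    have := f_mul (r := Q) (X := Q ^ b * X) hQ1 (hne b) (by rw [← e]; exact hne _)
    simp only [Function.comp_apply, e]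
    rw [this]
    have hp : 1 + Q ≠ 0 := by
      intro h
      have : Q = -1 := by linear_combination h
      rw [this] at h1; simp at h1
    have a : 1 - Q ≠ 0 := sub_ne_zero.2 (Ne.symm hQ1)
    have : Q * (1 + Q) / (1 - Q) ^ 3 ≠ 0 := div_ne_zero (mul_ne_zero hQ hp) (pow_ne_zero _ a)
    rw [add_sub_cancel_left, inv_mul_cancel_left₀ this]
  have t0 : Filter.Tendsto (fun n : ℕ => Q ^ n) Filter.atTop (nhds 0) :=
    tendsto_pow_atTop_nhds_zero_of_norm_lt_one h1
  have hp : Filter.Tendsto (fun n : ℕ => 1 / (1 - Q ^ (n : ℤ) * X)) Filter.atTop (nhds 1) := by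
    have t1 : Filter.Tendsto (fun n : ℕ => 1 / (1 - Q ^ n * X)) Filter.atTop (nhds (1 / (1 - 0 * X))) :=
      tendsto_const_nhds.div ((tendsto_const_nhds).sub (t0.mul_const X)) (by simp)
    simpa using t1
  have hm : Filter.Tendsto (fun n : ℕ => 1 / (1 - Q ^ (-(n : ℤ)) * X)) Filter.atTop (nhds 0) := by
    have t1 : Filter.Tendsto (fun n : ℕ => Q ^ n / (Q ^ n - X)) Filter.atTop (nhds (0 / (0 - X))) :=
      t0.div (t0.sub_const X) (by simpa using hX)
    rw [zero_div] at t1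
    refine t1.congr fun n => ?_
    have a : Q ^ n ≠ 0 := pow_ne_zero _ hQ
    have b : Q ^ n - X ≠ 0 := by
      intro h
      apply hne (-(n : ℤ))
      rw [zpow_neg, zpow_natCast, sub_eq_zero.1 h]
      rw [inv_mul_cancel₀ hX]
    rw [zpow_neg, zpow_natCast]
    field_simp
  have h3 := telescope_one (g := fun b : ℤ => 1 / (1 - Q ^ b * X)) hp hm hsum
  rw [sub_zero] at h3
  have h4 := telescope (g := fun b : ℤ => 1 / (1 - Q ^ b * X)) h3 k
  rwa [mul_one] at h4

/-- the quadratic relation -/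
theorem ode {Q X Y P P2 R R2 α : 𝕜} (hQ : Q ≠ 0) (h1 : ‖Q‖ < 1)
    (hX : X ≠ 0) (hXne : ∀ m : ℤ, Q ^ m * X ≠ 1) (hY : Y ≠ 0) (hYne : ∀ m : ℤ, Q ^ m * Y ≠ 1)
    (hP : HasSum (fun m : ℤ => f (Q ^ m * X)) P) (hP2 : HasSum (fun m : ℤ => f (Q ^ m * X) ^ 2) P2)
    (hR : HasSum (fun m : ℤ => f (Q ^ m * Y)) R) (hR2 : HasSum (fun m : ℤ => f (Q ^ m * Y) ^ 2) R2)
    (hα : HasSum (fun k : ℤ => f (Q ^ k)) α) :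
    P2 - R2 = (P - R) * (P + R - 2 * α) := by
  have main : ∀ {X P P2 : 𝕜}, X ≠ 0 → (∀ m : ℤ, Q ^ m * X ≠ 1) →
      HasSum (fun m : ℤ => f (Q ^ m * X)) P → HasSum (fun m : ℤ => f (Q ^ m * X) ^ 2) P2 →
      HasSum (fun k : ℤ => if k = 0 then P2 else f (Q ^ k) * (P + P) +
        Q ^ k * (1 + Q ^ k) / (1 - Q ^ k) ^ 3 * k) (P * P) := by
    intro X P P2 hX hne hP hP2
    refine conv_hasSum hP hP fun k => ?_
    by_cases hk : k = 0
    · subst hk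
      simpa [pow_two] using hP2
    · simp only [hk, if_false]
      have hs := ((Equiv.addRight k).hasSum_iff (f := fun m : ℤ => f (Q ^ m * X))).2 hP
      have := ((hs.add hP).mul_left (f (Q ^ k))).add
        ((e_telescope hQ h1 hX hne k).mul_left (Q ^ k * (1 + Q ^ k) / (1 - Q ^ k) ^ 3))
      refine this.congr_fun fun b => ?_
      have e : Q ^ (b + k) * X = Q ^ k * (Q ^ b * X) := by rw [zpow_add₀ hQ]; ring
      have := f_mul (r := Q ^ k) (X := Q ^ b * X) (norm_zpow_ne hQ h1 hk) (hne b) (by rw [← e]; exact hne _)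
      simp only [Function.comp_apply, Equiv.coe_addRight, e]
      exact this
  have h3 := (main hX hXne hP hP2).sub (main hY hYne hR hR2)
  have h4 := (hasSum_ite_eq (0 : ℤ) (P2 - R2)).add (hα.mul_right (2 * (P - R)))
  have := h3.unique (h4.congr_fun fun k => by
    by_cases hk : k = 0
    · subst hk; simp [f]
    · simp only [hk, if_false]; ring)
  linear_combination -this

/-- `∑ d³ x^d` -/
noncomputable def f2 (x : 𝕜) : 𝕜 := f x + 6 * f x ^ 2

lemma hasSum_f2 {x : 𝕜} (hx : ‖x‖ < 1) :
    HasSum (fun d : ℕ => ((d : 𝕜) + 1) ^ 3 * x ^ (d + 1)) (f2 x) := by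
  have a := hasSum_choose_mul_geometric_of_norm_lt_one 3 hx
  have b := hasSum_choose_mul_geometric_of_norm_lt_one 2 hx
  have c := hasSum_choose_mul_geometric_of_norm_lt_one 1 hx
  have := (((a.mul_left 6).sub (b.mul_left 6)).add c).mul_left x
  have e : x * (6 * (1 / (1 - x) ^ (3 + 1)) - 6 * (1 / (1 - x) ^ (2 + 1)) + 1 / (1 - x) ^ (1 + 1)) = f2 x := by
    have hx1 : 1 - x ≠ 0 := by
      intro h
      have : x = 1 := by linear_combination -h
      rw [this] at hx; simp at hx
    unfold f2 f; field_simp; ring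
  rw [e] at this
  refine this.congr_fun fun d => ?_
  have e3 : (((d + 3).choose 3 : ℕ) : 𝕜) * 6 = (d + 1) * (d + 2) * (d + 3) := by
    have := Nat.descFactorial_eq_factorial_mul_choose (d + 3) 3
    simp [Nat.descFactorial, Nat.factorial] at this
    have := congrArg (Nat.cast (R := 𝕜)) this
    push_cast at this
    linear_combination -this
  have e2 : (((d + 2).choose 2 : ℕ) : 𝕜) * 2 = (d + 1) * (d + 2) := by
    have := Nat.descFactorial_eq_factorial_mul_choose (d + 2) 2
    simp [Nat.descFactorial, Nat.factorial] at this
    have := congrArg (Nat.cast (R := 𝕜)) this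
    push_cast at this
    linear_combination -this
  rw [Nat.choose_one_right]
  push_cast
  rw [pow_succ]
  linear_combination (-x ^ d * x) * e3 + (3 * x ^ d * x) * e2

end

end RF

namespace RF

/-- `σ_{3;χ,1}` -/
def sig1 (n : ℕ) : ℤ := ∑ d ∈ n.divisors, chi (n / d) * (d : ℤ) ^ 3
/-- `σ_{3;1,χ}` -/
def sig2 (n : ℕ) : ℤ := ∑ d ∈ n.divisors, chi d * (d : ℤ) ^ 3

lemma hasSum_divisors {c : ℕ → ℕ → ℝ} {q S : ℝ}
    (h : HasSum (fun p : ℕ × ℕ => c (p.1 + 1) (p.2 + 1) * q ^ ((p.1 + 1) * (p.2 + 1))) S) :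
    HasSum (fun n : ℕ => (∑ d ∈ (n + 1).divisors, c ((n + 1) / d) d) * q ^ (n + 1)) S := by
  have h1 : HasSum (fun p : ℕ+ × ℕ+ => c p.1 p.2 * q ^ ((p.1 : ℕ) * p.2)) S := by
    rw [← (Equiv.prodCongr Equiv.pnatEquivNat.symm Equiv.pnatEquivNat.symm).hasSum_iff]
    refine h.congr_fun fun p => ?_
    simp
  have h2 := (sigmaAntidiagonalEquivProd.hasSum_iff).2 h1
  have h3 := h2.sigma (fun n => hasSum_fintype _)
  have h4 := (Equiv.pnatEquivNat.symm.hasSum_iff).2 h3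
  refine h4.congr_fun fun n => ?_
  simp only [Function.comp_apply]
  have e : ∀ y : ℕ × ℕ, y ∈ Nat.divisorsAntidiagonal (n + 1) → c y.1 y.2 * q ^ (y.1 * y.2) = c y.1 y.2 * q ^ (n + 1) := by
    intro y hy
    rw [(Nat.mem_divisorsAntidiagonal.1 hy).1]
  have e2 : ∑ d ∈ (n + 1).divisors, c ((n + 1) / d) d = ∑ y ∈ (n + 1).divisorsAntidiagonal, c y.1 y.2 :=
    (Nat.sum_divisorsAntidiagonal' (f := fun a b => c a b)).symm
  rw [e2, Finset.sum_mul, ← Finset.sum_congr rfl e, ← Finset.sum_coe_sort]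
  rfl

lemma summable_double {q : ℝ} (h0 : 0 < q) (h1 : q < 1) {c : ℕ → ℕ → ℝ} (hc : ∀ a b, |c a b| ≤ (b : ℝ) ^ 3) :
    Summable (fun p : ℕ × ℕ => c (p.1 + 1) (p.2 + 1) * q ^ ((p.1 + 1) * (p.2 + 1))) := by
  refine Summable.of_norm_bounded (summable_base h0 h1 3) fun p => ?_
  rw [norm_mul, Real.norm_eq_abs, Real.norm_eq_abs, abs_of_pos (pow_pos h0 _)]
  have := hc (p.1 + 1) (p.2 + 1)
  push_cast at this
  gcongr

lemma blocks {u : ℕ → ℝ} {S : ℝ} (N : ℕ) [NeZero N] (h : HasSum u S) :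
    HasSum (fun n : ℕ => ∑ r : Fin N, u (n * N + r)) S := by
  have h2 := ((Nat.divModEquiv N).symm.hasSum_iff).2 h
  refine h2.prod_fiberwise fun n => ?_
  have := hasSum_fintype (fun r : Fin N => u (n * N + r))
  refine this.congr_fun fun r => ?_
  simp

lemma zsum {g : ℤ → ℝ} {S : ℝ} (h : HasSum g S) : HasSum (fun n : ℕ => g n + g (-((n : ℤ) + 1))) S := by
  have a : Summable fun n : ℕ => g n := h.summable.comp_injective Nat.cast_injective
  have b : Summable fun n : ℕ => g (-((n : ℤ) + 1)) :=
    h.summable.comp_injective (i := fun n : ℕ => -((n : ℤ) + 1)) (fun x y h => by simpa using h)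
  have := HasSum.of_nat_of_neg_add_one (f := g) a.hasSum b.hasSum
  rw [h.unique this]
  exact a.hasSum.add b.hasSum

lemma f2_inv {𝕜 : Type*} [RCLike 𝕜] {x : 𝕜} (hx : x ≠ 0) (hx1 : x ≠ 1) : f2 x⁻¹ = f2 x := by
  unfold f2; rw [f_inv hx hx1]

section
variable {q : ℝ} (h0 : 0 < q) (h1 : q < 1)
include h0 h1

lemma zsum8 {g : ℝ → ℝ} {S : ℝ} (hg : ∀ x, 0 < x → x < 1 → g x⁻¹ = g x) {a b : ℕ} (hb : 0 < b) (hab : a + b = 8)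
    (h : HasSum (fun m : ℤ => g ((q ^ 8) ^ m * q ^ a)) S) :
    HasSum (fun n : ℕ => g (q ^ (n * 8 + a)) + g (q ^ (n * 8 + b))) S := by
  refine (zsum h).congr_fun fun n => ?_
  congr 1
  · rw [zpow_natCast, ← pow_mul, ← pow_add]; congr 2; ring
  · have : (q ^ 8) ^ (-((n : ℤ) + 1)) * q ^ a = (q ^ (n * 8 + b))⁻¹ := by
      rw [← zpow_natCast q 8, ← zpow_mul, ← zpow_natCast q a, ← zpow_natCast, ← zpow_neg, ← zpow_add₀ h0.ne']
      congr 1; push_cast; omega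
    rw [this, hg _ (by positivity) (pow_lt_one₀ h0.le h1 (by omega))]

lemma hs0 : HasSum (fun j : ℕ => f (q ^ j)) (s q) := by
  have := (hasSum_nat_add_iff (f := fun j : ℕ => f (q ^ j)) 1).1 (hs1 h0 h1)
  simpa [f] using this

lemma hα : HasSum (fun k : ℤ => f (q ^ k)) (2 * s q) := by
  have := hasSum_int_even (𝕜 := ℝ) (g := fun k : ℤ => f (q ^ k)) (s := s q)
    (fun m => by
      by_cases hm : m = 0
      · subst hm; simp
      · simp only [zpow_neg]; exact f_inv (zpow_ne_zero _ h0.ne') (zpow_ne_one h0 h1 hm))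
    ((hs1 h0 h1).congr_fun fun n => by
      have e : q ^ ((n : ℤ) + 1) = q ^ (n + 1) := by norm_cast
      rw [e])
  simpa [f] using this

lemma rels : A q ^ 2 = 1 + 8 * s q - 32 * s (q ^ 4) ∧
    A q * A (q ^ 2) = 1 + 8 * s (q ^ 4) - 32 * s (q ^ 8) + 4 * s q - 4 * s (q ^ 2) ∧
    A (q ^ 2) ^ 2 = 1 + 8 * s (q ^ 2) - 32 * s (q ^ 8) := by
  obtain ⟨g0, g1⟩ := sq_lt1 h0 h1
  have a := A_sq h0 h1
  have a2 := A_sq g0 g1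
  have b := AB_eq2 h0 h1
  have t := T_eq h0 h1
  have t2 := T_eq g0 g1
  have k := K_eq h0 h1
  have k2 := K_eq g0 g1
  simp only [← pow_mul] at *
  norm_num at *
  refine ⟨by linarith, by linarith, by linarith⟩

lemma pow_ne8 {a : ℕ} (ha : 0 < a) (ha8 : a < 8) (m : ℤ) : (q ^ 8) ^ m * q ^ a ≠ 1 := by
  have : (q ^ 8) ^ m * q ^ a = q ^ (8 * m + a) := by
    rw [zpow_add₀ h0.ne', zpow_mul, zpow_natCast]; norm_cast
  rw [this]
  exact zpow_ne_one h0 h1 (by omega)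

lemma hblock {g : ℝ → ℝ} {S : ℝ}
  (h : HasSum (fun j : ℕ => (chi (j + 1) : ℝ) * g (q ^ (j + 1))) S) :
    HasSum (fun n : ℕ => (g (q ^ (n * 8 + 1)) + g (q ^ (n * 8 + 7))) -
      (g (q ^ (n * 8 + 3)) + g (q ^ (n * 8 + 5)))) S := by
  have e0 : chi 0 = 0 := by decide
  have h2 := (hasSum_nat_add_iff (f := fun j : ℕ => (chi j : ℝ) * g (q ^ j)) 1).1 h
  simp only [Finset.range_one, Finset.sum_singleton, e0, Int.cast_zero, zero_mul, add_zero] at h2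
  refine (blocks (u := fun j : ℕ => (chi j : ℝ) * g (q ^ j)) 8 h2).congr_fun fun n => ?_
  have hc : ∀ r, chi (n * 8 + r) = chi r := by
    intro r
    induction n with
    | zero => simp
    | succ n ih => rw [← ih, ← chi_add (n * 8 + r)]; congr 1; ring
  simp only [Fin.sum_univ_eight, hc]
  have e1 : chi 1 = 1 := by decide
  have e2 : chi 2 = 0 := by decide
  have e3 : chi 3 = -1 := by decide
  have e4 : chi 4 = 0 := by decide
  have e5 : chi 5 = -1 := by decide
  have e6 : chi 6 = 0 := by decide
  have e7 : chi 7 = 1 := by decide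
  simp [e0, e1, e2, e3, e4, e5, e6, e7]
  ring

lemma F1_aux : ∃ V, HasSum (fun n : ℕ => (sig1 (n + 1) : ℝ) * q ^ (n + 1)) V ∧
    HasSum (fun j : ℕ => (chi (j + 1) : ℝ) * f2 (q ^ (j + 1))) V := by
  have hd := summable_double h0 h1 (c := fun a b => (chi a : ℝ) * (b : ℝ) ^ 3) (fun a b => by
    rw [abs_mul, abs_of_nonneg (show (0 : ℝ) ≤ (b : ℝ) ^ 3 by positivity)]
    exact mul_le_of_le_one_left (by positivity) (chi_abs _))
  obtain ⟨V, hV⟩ := hd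
  refine ⟨V, ?_, ?_⟩
  · have hV1 := hasSum_divisors (c := fun a b => (chi a : ℝ) * (b : ℝ) ^ 3) hV
    have e : ∀ n : ℕ, (sig1 (n + 1) : ℝ) = ∑ d ∈ (n + 1).divisors, (chi ((n + 1) / d) : ℝ) * (d : ℝ) ^ 3 := by
      intro n
      unfold sig1
      push_cast
      simp
    simp only [e]
    exact hV1
  · refine hV.prod_fiberwise fun j => ?_
    have := (hasSum_f2 (x := q ^ (j + 1)) (by
      rw [Real.norm_eq_abs, abs_of_pos (by positivity)]; exact pow_lt_one₀ h0.le h1 (by simp))).mul_left (chi (j + 1) : ℝ)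
    refine this.congr_fun fun d => ?_
    rw [← pow_mul]; push_cast; ring

theorem F1_eq : HasSum (fun n : ℕ => (sig1 (n + 1) : ℝ) * q ^ (n + 1))
    (L q * (A q - A (q ^ 2)) * (A q ^ 2 + 4 * (A q * A (q ^ 2)) - A (q ^ 2) ^ 2) / 16) := by
  obtain ⟨V, hV1, hV2⟩ := F1_aux h0 h1
  have q80 : 0 < q ^ 8 := by positivity
  have q81 : q ^ 8 < 1 := pow_lt_one₀ h0.le h1 (by norm_num)
  have hn : ‖q ^ 8‖ < 1 := by rwa [Real.norm_eq_abs, abs_of_pos q80]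
  have sX := summable_f (𝕜 := ℝ) q80.ne' hn (pow_ne_zero 1 h0.ne') (pow_ne8 h0 h1 (a := 1) (by norm_num) (by norm_num))
  have sY := summable_f (𝕜 := ℝ) q80.ne' hn (pow_ne_zero 3 h0.ne') (pow_ne8 h0 h1 (a := 3) (by norm_num) (by norm_num))
  have sX2 : Summable fun m : ℤ => f ((q ^ 8) ^ m * q ^ 1) ^ 2 := by
    simpa [pow_two] using summable_shift_mul sX 0
  have sY2 : Summable fun m : ℤ => f ((q ^ 8) ^ m * q ^ 3) ^ 2 := by
    simpa [pow_two] using summable_shift_mul sY 0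
  obtain ⟨P, hP⟩ := sX
  obtain ⟨R, hR⟩ := sY
  obtain ⟨P2, hP2⟩ := sX2
  obtain ⟨R2, hR2⟩ := sY2
  have hode := ode q80.ne' hn (pow_ne_zero 1 h0.ne') (pow_ne8 h0 h1 (a := 1) (by norm_num) (by norm_num))
    (pow_ne_zero 3 h0.ne') (pow_ne8 h0 h1 (a := 3) (by norm_num) (by norm_num)) hP hP2 hR hR2 (hα q80 q81)
  have finv : ∀ x : ℝ, 0 < x → x < 1 → f x⁻¹ = f x := fun x a b => f_inv a.ne' b.ne
  have f2inv : ∀ x : ℝ, 0 < x → x < 1 → f2 x⁻¹ = f2 x := fun x a b => f2_inv a.ne' b.ne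
  have zP := zsum8 h0 h1 (g := f) finv (a := 1) (b := 7) (by norm_num) rfl hP
  have zR := zsum8 h0 h1 (g := f) finv (a := 3) (b := 5) (by norm_num) rfl hR
  have zP2 := zsum8 h0 h1 (g := f2) f2inv (a := 1) (b := 7) (by norm_num) rfl (hP.add (hP2.mul_left 6))
  have zR2 := zsum8 h0 h1 (g := f2) f2inv (a := 3) (b := 5) (by norm_num) rfl (hR.add (hR2.mul_left 6))
  have w1 := (zP.sub zR).unique (hblock h0 h1 (g := f) (D1_eq h0 h1))
  have w2 := (zP2.sub zR2).unique (hblock h0 h1 (g := f2) hV2)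
  obtain ⟨g0, g1⟩ := sq_lt1 h0 h1
  have w3 : P + R = s q - s (q ^ 2) := by
    refine (zP.add zR).unique (((blocks 8 (hs0 h0 h1)).sub (blocks 4 (hs0 g0 g1))).congr_fun fun n => ?_)
    simp only [Fin.sum_univ_eight, Fin.sum_univ_four, ← pow_mul]
    simp
    have i0 : 2 * (n * 4) = n * 8 := by ring
    have i1 : 2 * (n * 4 + 1) = n * 8 + 2 := by ring
    have i2 : 2 * (n * 4 + 2) = n * 8 + 4 := by ring
    have i3 : 2 * (n * 4 + 3) = n * 8 + 6 := by ring
    rw [i0, i1, i2, i3]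
    ring
  obtain ⟨r1, r2, r3⟩ := rels h0 h1
  have hVe : V = L q * (A q - A (q ^ 2)) * (A q ^ 2 + 4 * (A q * A (q ^ 2)) - A (q ^ 2) ^ 2) / 16 := by
    rw [r1, r2, r3, ← w2]
    have : P + 6 * P2 - (R + 6 * R2) = (P - R) * (1 + 6 * (P + R) - 12 * (2 * s (q ^ 8))) := by
      linear_combination 6 * hode
    rw [this, w1, w3]
    ring
  rw [← hVe]
  exact hV1

end

section
variable {ζ : ℂ} (hz : ζ ^ 4 = -1)
include hz

lemma fz {X u : ℂ} (hX : X ^ 4 = - u ^ 4) (hu : 1 + u ^ 4 ≠ 0) :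
    f X = ((1 - 3 * u ^ 4) * X + (2 - 2 * u ^ 4) * X ^ 2 + (3 - u ^ 4) * X ^ 3 - 4 * u ^ 4) / (1 + u ^ 4) ^ 2 := by
  have h1 : 1 - X ≠ 0 := by
    intro h
    apply hu
    have : X = 1 := by linear_combination -h
    rw [this] at hX
    linear_combination hX
  have hu' : 1 + u ^ 4 = 1 - X ^ 4 := by rw [hX]; ring
  have e4 : u ^ 4 = - X ^ 4 := by rw [hX]; ring
  unfold f
  rw [div_eq_div_iff (pow_ne_zero _ h1) (pow_ne_zero _ hu), e4]
  ring

lemma z_pows : (ζ ^ 3) ^ 4 = -1 ∧ (-ζ) ^ 4 = -1 ∧ (-ζ ^ 3) ^ 4 = -1 := by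
  have : ζ ^ 12 = -1 := by
    have : ζ ^ 12 = (ζ ^ 4) ^ 3 := by ring
    rw [this, hz]; norm_num
  refine ⟨?_, ?_, ?_⟩
  · rw [← pow_mul]; exact this
  · rw [← hz]; ring
  · rw [← this]; ring

lemma alg (u : ℝ) :
    f ((u : ℂ) * ζ) + f (u * -ζ ^ 3) - f (u * ζ ^ 3) - f (u * -ζ) =
      -2 * (ζ - ζ ^ 3) * ((C u * (2 * S (u ^ 2) - 1) : ℝ) : ℂ) ∧
    f ((u : ℂ) * ζ) + f (u * -ζ ^ 3) + f (u * ζ ^ 3) + f (u * -ζ) =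
      -4 * ((S (u ^ 2) ^ 2 : ℝ) : ℂ) := by
  have hur : (1 : ℝ) + u ^ 4 ≠ 0 := by positivity
  have hu : (1 : ℂ) + u ^ 4 ≠ 0 := by exact_mod_cast hur
  obtain ⟨z3, zm, zm3⟩ := z_pows hz
  have z9 : ζ ^ 9 = ζ := by
    have : ζ ^ 9 = ζ * (ζ ^ 4) ^ 2 := by ring
    rw [this, hz]; norm_num
  have z6 : ζ ^ 6 = - ζ ^ 2 := by
    have : ζ ^ 6 = ζ ^ 2 * ζ ^ 4 := by ring
    rw [this, hz]; ring
  rw [fz hz (X := u * ζ) (u := u) (by rw [mul_pow, hz]; ring) hu,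
    fz hz (X := u * -ζ ^ 3) (u := u) (by rw [mul_pow, zm3]; ring) hu,
    fz hz (X := u * ζ ^ 3) (u := u) (by rw [mul_pow, z3]; ring) hu,
    fz hz (X := u * -ζ) (u := u) (by rw [mul_pow, zm]; ring) hu]
  have e1 : (1 : ℝ) + (u ^ 2) ^ 2 = 1 + u ^ 4 := by ring
  unfold C S
  rw [e1]
  push_cast
  constructor
  · field_simp
    linear_combination (- 2 * u ^ 3 * (3 - u ^ 4)) * z9
  · field_simp
    linear_combination (4 * u ^ 2 * (1 - u ^ 4)) * z6

lemma alg2 : f2 (1 * ζ) + f2 (1 * -ζ ^ 3) - f2 (1 * ζ ^ 3) - f2 (1 * -ζ) = 22 * (ζ - ζ ^ 3) := by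
  obtain ⟨z3, zm, zm3⟩ := z_pows hz
  have z9 : ζ ^ 9 = ζ := by
    have : ζ ^ 9 = ζ * (ζ ^ 4) ^ 2 := by ring
    rw [this, hz]; norm_num
  have i1 : f ζ = -(ζ - ζ ^ 3) / 2 - 1 := by
    rw [fz hz (X := ζ) (u := 1) (by rw [hz]; ring) (by norm_num)]; ring
  have i2 : f (-ζ) = (ζ - ζ ^ 3) / 2 - 1 := by
    rw [fz hz (X := -ζ) (u := 1) (by rw [zm]; ring) (by norm_num)]; ring
  have i3 : f (ζ ^ 3) = (ζ - ζ ^ 3) / 2 - 1 := by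
    rw [fz hz (X := ζ ^ 3) (u := 1) (by rw [z3]; ring) (by norm_num)]
    linear_combination (1 / 2) * z9
  have i4 : f (-ζ ^ 3) = -(ζ - ζ ^ 3) / 2 - 1 := by
    rw [fz hz (X := -ζ ^ 3) (u := 1) (by rw [zm3]; ring) (by norm_num)]
    linear_combination (-1 / 2) * z9
  unfold f2
  rw [one_mul, one_mul, one_mul, one_mul, i1, i2, i3, i4]
  ring

lemma z_chi (n : ℕ) : ζ ^ n + (-ζ ^ 3) ^ n - (ζ ^ 3) ^ n - (-ζ) ^ n = 2 * (ζ - ζ ^ 3) * (chi n : ℂ) := by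
  have e0 : chi 0 = 0 := by decide
  have e1 : chi 1 = 1 := by decide
  have e2 : chi 2 = 0 := by decide
  have e3 : chi 3 = -1 := by decide
  have e4 : chi 4 = 0 := by decide
  have e5 : chi 5 = -1 := by decide
  have e6 : chi 6 = 0 := by decide
  have e7 : chi 7 = 1 := by decide
  have z8 : ζ ^ 8 = 1 := by
    have : ζ ^ 8 = (ζ ^ 4) ^ 2 := by ring
    rw [this, hz]; norm_num
  have z9 : ζ ^ 9 = ζ := by
    have : ζ ^ 9 = ζ * (ζ ^ 4) ^ 2 := by ring
    rw [this, hz]; norm_num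
  have z5 : ζ ^ 5 = -ζ := by
    have : ζ ^ 5 = ζ * (ζ ^ 4) := by ring
    rw [this, hz]; ring
  have z7 : ζ ^ 7 = -ζ ^ 3 := by
    have : ζ ^ 7 = ζ ^ 3 * (ζ ^ 4) := by ring
    rw [this, hz]; ring
  have z15 : ζ ^ 15 = -ζ ^ 3 := by
    have : ζ ^ 15 = ζ ^ 3 * (ζ ^ 4) ^ 3 := by ring
    rw [this, hz]; ring
  have z21 : ζ ^ 21 = -ζ := by
    have : ζ ^ 21 = ζ * (ζ ^ 4) ^ 5 := by ring
    rw [this, hz]; ring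
  have a3 : (ζ ^ 3) ^ 8 = 1 := by rw [pow_right_comm, z8, one_pow]
  have am : (-ζ) ^ 8 = 1 := by rw [← z8]; ring
  have am3 : (-ζ ^ 3) ^ 8 = 1 := by rw [← a3]; ring
  have step : ∀ n : ℕ, n < 8 → ζ ^ n + (-ζ ^ 3) ^ n - (ζ ^ 3) ^ n - (-ζ) ^ n = 2 * (ζ - ζ ^ 3) * (chi n : ℂ) := by
    intro n hn
    interval_cases n
    · simp [e0]
    · simp [e1]; ring
    · simp [e2]
    · simp [e3]; linear_combination (-2) * z9
    · simp [e4]; ring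
    · simp [e5]; linear_combination 2 * z5 - 2 * z15
    · simp [e6]; ring
    · simp [e7]; linear_combination 2 * z7 - 2 * z21
  induction n using Nat.strong_induction_on with
  | _ n ih =>
    rcases lt_or_ge n 8 with h | h
    · exact step n h
    · obtain ⟨k, rfl⟩ := Nat.exists_eq_add_of_le' h
      rw [chi_add, pow_add, pow_add, pow_add, pow_add, z8, a3, am, am3]
      simpa using ih k (by omega)

end

lemma exists_zeta : ∃ ζ : ℂ, ζ ^ 4 = -1 := IsAlgClosed.exists_pow_nat_eq (-1) (by norm_num)

end RF

namespace RF

section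
variable {q : ℝ} (h0 : 0 < q) (h1 : q < 1)
include h0 h1

lemma F2_aux : ∃ V, HasSum (fun n : ℕ => (sig2 (n + 1) : ℝ) * q ^ (n + 1)) V ∧
    ∃ W : ℝ → ℝ, (∀ u, 0 < u → u < 1 → HasSum (fun d : ℕ => (chi (d + 1) : ℝ) * (((d : ℝ) + 1) ^ 3 * u ^ (d + 1))) (W u)) ∧
    HasSum (fun j : ℕ => W (q ^ (j + 1))) V := by
  have hd := summable_double h0 h1 (c := fun a b => (chi b : ℝ) * (b : ℝ) ^ 3) (fun a b => by
    rw [abs_mul, abs_of_nonneg (show (0 : ℝ) ≤ (b : ℝ) ^ 3 by positivity)]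
    exact mul_le_of_le_one_left (by positivity) (chi_abs _))
  obtain ⟨V, hV⟩ := hd
  have hW : ∀ u : ℝ, 0 < u → u < 1 → HasSum (fun d : ℕ => (chi (d + 1) : ℝ) * (((d : ℝ) + 1) ^ 3 * u ^ (d + 1)))
      (∑' d : ℕ, (chi (d + 1) : ℝ) * (((d : ℝ) + 1) ^ 3 * u ^ (d + 1))) := by
    intro u u0 u1
    refine Summable.hasSum ?_
    have := (hasSum_f2 (x := u) (by rwa [Real.norm_eq_abs, abs_of_pos u0])).summable
    refine Summable.of_norm_bounded this fun d => ?_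
    rw [norm_mul, Real.norm_eq_abs, Real.norm_eq_abs, abs_of_nonneg (show 0 ≤ ((d : ℝ) + 1) ^ 3 * u ^ (d + 1) by positivity)]
    exact mul_le_of_le_one_left (by positivity) (chi_abs _)
  refine ⟨V, ?_, fun u => ∑' d : ℕ, (chi (d + 1) : ℝ) * (((d : ℝ) + 1) ^ 3 * u ^ (d + 1)), hW, ?_⟩
  · have hV1 := hasSum_divisors (c := fun a b => (chi b : ℝ) * (b : ℝ) ^ 3) hV
    have e : ∀ n : ℕ, (sig2 (n + 1) : ℝ) = ∑ d ∈ (n + 1).divisors, (chi d : ℝ) * (d : ℝ) ^ 3 := by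
      intro n
      unfold sig2
      push_cast
      simp
    simp only [e]
    exact hV1
  · refine hV.prod_fiberwise fun j => ?_
    have := hW (q ^ (j + 1)) (by positivity) (pow_lt_one₀ h0.le h1 (by simp))
    refine this.congr_fun fun d => ?_
    rw [← pow_mul]; push_cast; ring

lemma zeta_ne {ζ : ℂ} (hz : ζ ^ 4 = -1) (m : ℤ) : (q : ℂ) ^ m * ζ ≠ 1 := by
  intro h
  have h2 : ((q : ℂ) ^ m * ζ) ^ 4 = 1 := by rw [h]; norm_num
  rw [mul_pow, hz] at h2
  have h3 : (((q ^ m) ^ 4 * (-1) : ℝ) : ℂ) = ((1 : ℝ) : ℂ) := by push_cast; exact h2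
  have h4 := Complex.ofReal_injective h3
  have := zpow_pos h0 m
  have : 0 < (q ^ m) ^ 4 := by positivity
  linarith

lemma sym_sum {ζ η : ℂ} (hζ : ζ ^ 4 = -1) (hη : ζ * η = 1) {g : ℂ → ℂ} (hg : ∀ x : ℂ, x ≠ 0 → x ≠ 1 → g x⁻¹ = g x)
    {P : ℂ} (h : HasSum (fun m : ℤ => g ((q : ℂ) ^ m * ζ)) P) :
    HasSum (fun m : ℤ => g ((q : ℂ) ^ m * η)) P := by
  have := ((Equiv.neg ℤ).hasSum_iff (f := fun m : ℤ => g ((q : ℂ) ^ m * ζ))).2 h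
  refine this.congr_fun fun m => ?_
  have hq : (q : ℂ) ≠ 0 := by exact_mod_cast h0.ne'
  have hz0 : ζ ≠ 0 := left_ne_zero_of_mul_eq_one hη
  have e : (q : ℂ) ^ m * η = ((q : ℂ) ^ (-m) * ζ)⁻¹ := by
    rw [mul_inv, zpow_neg, inv_inv, eq_inv_of_mul_eq_one_right hη]
  simp only [Function.comp_apply, Equiv.neg_apply]
  rw [e, hg _ (mul_ne_zero (zpow_ne_zero _ hq) hz0) (zeta_ne h0 h1 hζ _)]

theorem F2_eq : HasSum (fun n : ℕ => (sig2 (n + 1) : ℝ) * q ^ (n + 1))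
    (L q * (2 * A (q ^ 2) - A q) * (4 * A (q ^ 2) ^ 2 + 8 * (A q * A (q ^ 2)) - A q ^ 2) / 2 - 11 / 2) := by
  obtain ⟨V, hV, W, hW, hWV⟩ := F2_aux h0 h1
  obtain ⟨g0, g1⟩ := sq_lt1 h0 h1
  obtain ⟨ζ, hz⟩ := exists_zeta
  obtain ⟨z3, zm, zm3⟩ := z_pows hz
  have hq : (q : ℂ) ≠ 0 := by exact_mod_cast h0.ne'
  have hn : ‖(q : ℂ)‖ < 1 := by rw [Complex.norm_real, Real.norm_eq_abs, abs_of_pos h0]; exact h1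
  have hz0 : ζ ≠ 0 := by rintro rfl; norm_num at hz
  have hz30 : ζ ^ 3 ≠ 0 := pow_ne_zero _ hz0
  have p1 : ζ * -ζ ^ 3 = 1 := by linear_combination -hz
  have p3 : ζ ^ 3 * -ζ = 1 := by linear_combination -hz
  have sX := summable_f hq hn hz0 (zeta_ne h0 h1 hz)
  have sY := summable_f hq hn hz30 (zeta_ne h0 h1 z3)
  have sX2 : Summable fun m : ℤ => f ((q : ℂ) ^ m * ζ) ^ 2 := by
    simpa [pow_two] using summable_shift_mul sX 0
  have sY2 : Summable fun m : ℤ => f ((q : ℂ) ^ m * ζ ^ 3) ^ 2 := by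
    simpa [pow_two] using summable_shift_mul sY 0
  obtain ⟨P, hP⟩ := sX
  obtain ⟨R, hR⟩ := sY
  obtain ⟨P2, hP2⟩ := sX2
  obtain ⟨R2, hR2⟩ := sY2
  have hαc : HasSum (fun k : ℤ => f ((q : ℂ) ^ k)) ((2 * s q : ℝ) : ℂ) := by
    have := Complex.hasSum_ofReal.2 (hα h0 h1)
    refine this.congr_fun fun k => ?_
    unfold f; push_cast; rfl
  have hode := ode hq hn hz0 (zeta_ne h0 h1 hz) hz30 (zeta_ne h0 h1 z3) hP hP2 hR hR2 hαc
  have cast : ∀ m : ℤ, ((q ^ m : ℝ) : ℂ) = (q : ℂ) ^ m := fun m => by push_cast; rfl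
  have finv : ∀ x : ℂ, x ≠ 0 → x ≠ 1 → f x⁻¹ = f x := fun x a b => f_inv a b
  have f2inv : ∀ x : ℂ, x ≠ 0 → x ≠ 1 → f2 x⁻¹ = f2 x := fun x a b => f2_inv a b
  have hP' := sym_sum h0 h1 hz p1 (g := f) finv hP
  have hR' := sym_sum h0 h1 z3 p3 (g := f) finv hR
  have hPP : HasSum (fun m : ℤ => f2 ((q : ℂ) ^ m * ζ)) (P + 6 * P2) := hP.add (hP2.mul_left 6)
  have hRR : HasSum (fun m : ℤ => f2 ((q : ℂ) ^ m * ζ ^ 3)) (R + 6 * R2) := hR.add (hR2.mul_left 6)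
  have hPP' := sym_sum h0 h1 hz p1 (g := f2) f2inv hPP
  have hRR' := sym_sum h0 h1 z3 p3 (g := f2) f2inv hRR
  have w1 : P + P - R - R = -2 * (ζ - ζ ^ 3) * ((L q * (2 * A (q ^ 2) - A q) : ℝ) : ℂ) := by
    refine (((hP.add hP').sub hR).sub hR').unique ?_
    refine ((Complex.hasSum_ofReal.2 (LB_eq h0 h1)).mul_left (-2 * (ζ - ζ ^ 3))).congr_fun fun m => ?_
    rw [← (alg hz (q ^ m)).1, cast]
  have w2 : P + P + R + R = -4 * ((T (q ^ 2) : ℝ) : ℂ) := by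
    refine (((hP.add hP').add hR).add hR').unique ?_
    refine ((Complex.hasSum_ofReal.2 (hT g0 g1)).mul_left (-4)).congr_fun fun m => ?_
    rw [sq_zpow', ← (alg hz (q ^ m)).2, cast]
  have hG : ∀ u : ℝ, 0 < u → u < 1 → f2 ((u : ℂ) * ζ) + f2 (u * -ζ ^ 3) - f2 (u * ζ ^ 3) - f2 (u * -ζ)
      = 2 * (ζ - ζ ^ 3) * ((W u : ℝ) : ℂ) := by
    intro u u0 u1
    have hnorm : ∀ w : ℂ, w ^ 4 = -1 → ‖(u : ℂ) * w‖ < 1 := by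
      intro w hw
      have : ‖w‖ ^ 4 = 1 := by rw [← norm_pow, hw]; simp
      have : ‖w‖ = 1 := by
        rwa [pow_eq_one_iff_of_nonneg (norm_nonneg _) (by norm_num)] at this
      rw [norm_mul, this, mul_one, Complex.norm_real, Real.norm_eq_abs, abs_of_pos u0]; exact u1
    have := (((hasSum_f2 (hnorm _ hz)).add (hasSum_f2 (hnorm _ zm3))).sub (hasSum_f2 (hnorm _ z3))).sub
      (hasSum_f2 (hnorm _ zm))
    refine this.unique ?_
    refine ((Complex.hasSum_ofReal.2 (hW u u0 u1)).mul_left (2 * (ζ - ζ ^ 3))).congr_fun fun d => ?_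
    have hc := z_chi hz (d + 1)
    push_cast
    simp only [mul_pow]
    linear_combination ((d : ℂ) + 1) ^ 3 * (u : ℂ) ^ (d + 1) * hc
  have w3 : (P + 6 * P2) + (P + 6 * P2) - (R + 6 * R2) - (R + 6 * R2) =
      22 * (ζ - ζ ^ 3) + 2 * (2 * (ζ - ζ ^ 3) * (V : ℂ)) := by
    refine (((hPP.add hPP').sub hRR).sub hRR').unique ?_
    have := hasSum_int_even (𝕜 := ℂ) (g := fun m : ℤ => f2 ((q : ℂ) ^ m * ζ) + f2 ((q : ℂ) ^ m * -ζ ^ 3) -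
      f2 ((q : ℂ) ^ m * ζ ^ 3) - f2 ((q : ℂ) ^ m * -ζ)) (s := 2 * (ζ - ζ ^ 3) * (V : ℂ))
      (fun m => by
        have key : ∀ a b : ℂ, a ^ 4 = -1 → a * b = 1 → f2 ((q : ℂ) ^ (-m) * a) = f2 ((q : ℂ) ^ m * b) := by
          intro a b ha hab
          have ha0 : a ≠ 0 := left_ne_zero_of_mul_eq_one hab
          have e : (q : ℂ) ^ m * b = ((q : ℂ) ^ (-m) * a)⁻¹ := by
            rw [mul_inv, zpow_neg, inv_inv, eq_inv_of_mul_eq_one_right hab]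
          rw [e, f2inv _ (mul_ne_zero (zpow_ne_zero _ hq) ha0) (zeta_ne h0 h1 ha _)]
        rw [key ζ _ hz p1, key (-ζ ^ 3) ζ zm3 (by rw [mul_comm]; exact p1), key _ _ z3 p3,
          key (-ζ) (ζ ^ 3) zm (by rw [mul_comm]; exact p3)]
        ring)
      (((Complex.hasSum_ofReal.2 hWV).mul_left (2 * (ζ - ζ ^ 3))).congr_fun fun n => by
        have e : (q : ℂ) ^ ((n : ℤ) + 1) = ((q ^ (n + 1) : ℝ) : ℂ) := by push_cast; norm_cast
        simp only [e]
        exact hG _ (by positivity) (pow_lt_one₀ h0.le h1 (by simp)))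
    have e := alg2 hz
    simp only [zpow_zero, e] at this
    exact this
  obtain ⟨r1, r2, r3⟩ := rels h0 h1
  have t2 := T_eq g0 g1
  simp only [← pow_mul] at t2
  norm_num at t2
  have hτ : ζ - ζ ^ 3 ≠ 0 := by
    intro h
    have h2 : (ζ - ζ ^ 3) ^ 2 = 2 := by linear_combination (ζ ^ 2 - 2) * hz
    rw [h] at h2; norm_num at h2
  have hVc : ((11 + 2 * V : ℝ) : ℂ) = ((L q * (2 * A (q ^ 2) - A q) * (12 * T (q ^ 2) + 24 * s q - 1) : ℝ) : ℂ) := by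
    push_cast at w1 w2 w3 hode ⊢
    apply mul_left_cancel₀ hτ
    have e1 : P - R = -(ζ - ζ ^ 3) * (L q * (2 * A (q ^ 2) - A q)) := by linear_combination w1 / 2
    have e2 : P + R = -2 * T (q ^ 2) := by linear_combination w2 / 2
    have e3 : (P + 6 * P2) - (R + 6 * R2) = (P - R) * (1 + 6 * (P + R) - 24 * s q) := by
      linear_combination 6 * hode
    rw [e1, e2] at e3
    linear_combination e3 - w3 / 2
  have hVr := Complex.ofReal_injective hVc
  have hVe : V = L q * (2 * A (q ^ 2) - A q) * (4 * A (q ^ 2) ^ 2 + 8 * (A q * A (q ^ 2)) - A q ^ 2) / 2 - 11 / 2 := by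
    rw [r1, r2, r3]
    rw [t2] at hVr
    linear_combination hVr / 2
  rw [← hVe]
  exact hV

end

end RF

namespace RF
open Filter Topology

/-- Euler product -/
noncomputable def EE (q : ℝ) : ℝ := ∏' n : ℕ, (1 - q ^ (n + 1))

section
variable {q : ℝ} (h0 : 0 < q) (h1 : q < 1)
include h0 h1

lemma EE_mult : Multipliable fun n : ℕ => (1 - q ^ (n + 1)) := by
  have := multipliable_one_add_of_summable (f := fun n : ℕ => -q ^ (n + 1)) (geo h0 h1).summable.neg.norm
  simpa [sub_eq_add_neg] using this

lemma EE_tendsto : Tendsto (fun n : ℕ => ∏ i ∈ Finset.range n, (1 - q ^ (i + 1))) atTop (𝓝 (EE q)) :=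
  (EE_mult h0 h1).hasProd.tendsto_prod_nat

lemma fac_pos (n : ℕ) : 0 < 1 - q ^ (n + 1) := by
  have := pow_lt_one₀ h0.le h1 (Nat.succ_ne_zero n)
  simp only [Nat.succ_eq_add_one] at this
  linarith

lemma EE_pos : 0 < EE q := by
  refine lt_of_le_of_ne (ge_of_tendsto' (EE_tendsto h0 h1) fun n =>
    Finset.prod_nonneg fun i _ => (fac_pos h0 h1 i).le) (Ne.symm ?_)
  have := tprod_one_add_ne_zero_of_summable (f := fun n : ℕ => -q ^ (n + 1))
    (fun n => by have := fac_pos h0 h1 n; rw [← sub_eq_add_neg]; exact this.ne')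
    (geo h0 h1).summable.neg.norm
  simpa [EE, sub_eq_add_neg] using this

lemma EE_le_one : EE q ≤ 1 :=
  le_of_tendsto' (EE_tendsto h0 h1) fun n =>
    Finset.prod_le_one (fun i _ => (fac_pos h0 h1 i).le) fun i _ => by
      have := pow_pos h0 (i + 1); linarith

lemma EE_lower (h2 : q ≤ 1 / 4) : 2 / 3 ≤ EE q := by
  refine ge_of_tendsto' (EE_tendsto h0 h1) fun n => ?_
  have a : ∀ n : ℕ, 1 - ∑ i ∈ Finset.range n, q ^ (i + 1) ≤ ∏ i ∈ Finset.range n, (1 - q ^ (i + 1)) := by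
    intro n
    induction n with
    | zero => simp
    | succ n ih =>
      rw [Finset.sum_range_succ, Finset.prod_range_succ]
      have b : ∏ i ∈ Finset.range n, (1 - q ^ (i + 1)) ≤ 1 :=
        Finset.prod_le_one (fun i _ => (fac_pos h0 h1 i).le) fun i _ => by
          have := pow_pos h0 (i + 1); linarith
      have c := pow_pos h0 (n + 1)
      nlinarith
  have b := (geo h0 h1).summable.sum_le_tsum (Finset.range n) (fun i _ => (pow_pos h0 (i + 1)).le)
  rw [(geo h0 h1).tsum_eq] at b
  have c : q / (1 - q) ≤ 1 / 3 := by rw [div_le_iff₀ (by linarith)]; linarith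
  linarith [a n]

end

/-- Shanks partial product -/
noncomputable def QQ (x : ℝ) (n : ℕ) : ℝ := ∏ i ∈ Finset.range n, ((1 - x ^ (i + 1)) / (1 + x ^ (i + 1)))

/-- Shanks coefficient -/
noncomputable def cc (x : ℝ) (s : ℕ) : ℝ := if s = 0 then 1 else 2 / (1 + x ^ s)

/-- Shanks term -/
noncomputable def FF (x : ℝ) (n s : ℕ) : ℝ := (-1) ^ s * cc x s * (QQ x n / QQ x s) * x ^ (s * (n + 1))

section
variable {q : ℝ} (h0 : 0 < q) (h1 : q < 1)
include h0 h1

lemma QQ_pos (n : ℕ) : 0 < QQ q n :=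
  Finset.prod_pos fun i _ => div_pos (fac_pos h0 h1 i) (by positivity)

lemma QQ_anti {m n : ℕ} (h : m ≤ n) : QQ q n ≤ QQ q m := by
  refine antitone_nat_of_succ_le (f := QQ q) (fun n => ?_) h
  rw [QQ, Finset.prod_range_succ, ← QQ]
  refine mul_le_of_le_one_right (QQ_pos h0 h1 n).le ?_
  have := pow_pos h0 (n + 1)
  rw [div_le_one (by positivity)]; linarith

lemma shanks_aux (n m : ℕ) : ∑ s ∈ Finset.range (m + 1), (FF q (n + 1) s - FF q n s) =
    (2 * QQ q n / (1 + q ^ (n + 1))) * (-1) ^ (m + 1) * q ^ ((m + 1) * (n + 1)) / QQ q m := by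
  have a := pow_pos h0 (n + 1)
  have e : QQ q (n + 1) = QQ q n * ((1 - q ^ (n + 1)) / (1 + q ^ (n + 1))) := by
    rw [QQ, Finset.prod_range_succ, ← QQ]
  induction m with
  | zero =>
    simp only [FF, cc, zero_add, Finset.sum_range_one, e, if_true]
    simp [QQ]
    field_simp
    ring
  | succ m ih =>
    rw [Finset.sum_range_succ, ih]
    have e2 : QQ q (m + 1) = QQ q m * ((1 - q ^ (m + 1)) / (1 + q ^ (m + 1))) := by
      rw [QQ, Finset.prod_range_succ, ← QQ]
    have b := QQ_pos h0 h1 m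
    have c := fac_pos h0 h1 m
    have c2 := pow_pos h0 (m + 1)
    simp only [FF, cc, Nat.succ_ne_zero, if_false, e, e2]
    have p1 : q ^ ((m + 1) * (n + 1 + 1)) = q ^ ((m + 1) * (n + 1)) * q ^ (m + 1) := by
      rw [← pow_add]; ring_nf
    have p2 : q ^ ((m + 1 + 1) * (n + 1)) = q ^ ((m + 1) * (n + 1)) * q ^ (n + 1) := by
      rw [← pow_add]; congr 1; ring
    rw [p1, p2, pow_succ (-1 : ℝ) (m + 1)]
    generalize q ^ ((m + 1) * (n + 1)) = X at *
    generalize q ^ (m + 1) = Y at *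
    generalize q ^ (n + 1) = Z at *
    generalize (-1 : ℝ) ^ (m + 1) = W
    have := c.ne'
    field_simp
    ring

lemma shanks (n : ℕ) : ∑ s ∈ Finset.range (n + 1), FF q n s =
    1 + 2 * ∑ s ∈ Finset.range n, (-1) ^ (s + 1) * q ^ ((s + 1) ^ 2) := by
  induction n with
  | zero => simp [FF, cc, QQ]
  | succ n ih =>
    have := shanks_aux h0 h1 n n
    rw [Finset.sum_sub_distrib, ih] at this
    rw [Finset.sum_range_succ (fun s => FF q (n + 1) s) (n + 1), Finset.sum_range_succ (fun s => (-1 : ℝ) ^ (s + 1) * q ^ ((s + 1) ^ 2)) n]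
    have e : FF q (n + 1) (n + 1) = (-1) ^ (n + 1) * (2 / (1 + q ^ (n + 1))) * (q ^ ((n + 1) ^ 2) * q ^ (n + 1)) := by
      rw [FF, div_self (QQ_pos h0 h1 _).ne', ← pow_add, cc, if_neg (Nat.succ_ne_zero n), mul_one]
      congr 2; ring
    rw [e]
    have p : q ^ ((n + 1) * (n + 1)) = q ^ ((n + 1) ^ 2) := by congr 1; ring
    rw [p] at this
    have b := QQ_pos h0 h1 n
    have a := pow_pos h0 (n + 1)
    have t : 2 * QQ q n / (1 + q ^ (n + 1)) * (-1) ^ (n + 1) * q ^ ((n + 1) ^ 2) / QQ q n =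
      2 / (1 + q ^ (n + 1)) * (-1) ^ (n + 1) * q ^ ((n + 1) ^ 2) := by field_simp
    rw [t] at this
    have t2 : 2 / (1 + q ^ (n + 1)) * (1 + q ^ (n + 1)) = 2 := by field_simp
    linear_combination this + (-1) ^ (n + 1) * q ^ ((n + 1) ^ 2) * t2

lemma QQ_tendsto : Tendsto (QQ q) atTop (𝓝 (EE q ^ 2 / EE (q ^ 2))) := by
  obtain ⟨g0, g1⟩ := sq_lt1 h0 h1
  have := ((EE_tendsto h0 h1).pow 2).div (EE_tendsto g0 g1) (EE_pos g0 g1).ne'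
  refine this.congr fun n => ?_
  simp only [Pi.div_apply, QQ]
  rw [← Finset.prod_pow, ← Finset.prod_div_distrib]
  refine Finset.prod_congr rfl fun i _ => ?_
  have a := fac_pos h0 h1 i
  have b := pow_pos h0 (i + 1)
  have e : 1 - (q ^ 2) ^ (i + 1) = (1 - q ^ (i + 1)) * (1 + q ^ (i + 1)) := by ring
  rw [e]
  have := a.ne'
  field_simp

lemma thn_nat : Tendsto (fun n : ℕ => 1 + 2 * ∑ s ∈ Finset.range n, (-1) ^ (s + 1) * q ^ ((s + 1) ^ 2))
    atTop (𝓝 (thn q)) := by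
  have hs : Summable fun s : ℕ => (-1 : ℝ) ^ (s + 1) * q ^ ((s + 1) ^ 2) := by
    refine Summable.of_norm_bounded (geo h0 h1).summable fun s => ?_
    rw [norm_mul, norm_pow, norm_neg, norm_one, one_pow, one_mul, Real.norm_of_nonneg (by positivity)]
    exact pow_le_pow_of_le_one h0.le h1.le (by nlinarith)
  have := hasSum_int_even (𝕜 := ℝ) (g := fun m : ℤ => (-1) ^ m * q ^ (m ^ 2))
    (fun m => by simp [zpow_neg, ← inv_zpow])
    (s := ∑' s : ℕ, (-1 : ℝ) ^ (s + 1) * q ^ ((s + 1) ^ 2)) (hs.hasSum.congr_fun fun n => by norm_cast)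
  rw [(hthn h0 h1).unique this]
  have t := (hs.hasSum.tendsto_sum_nat.const_mul 2).const_add 1
  simpa using t

lemma thn_eq : thn q = EE q ^ 2 / EE (q ^ 2) := by
  have a := QQ_tendsto h0 h1
  have b := thn_nat h0 h1
  refine tendsto_nhds_unique b ?_
  have key : ∀ n : ℕ, |(1 + 2 * ∑ s ∈ Finset.range n, (-1) ^ (s + 1) * q ^ ((s + 1) ^ 2)) - QQ q n| ≤
      2 * (n * q ^ n) := by
    intro n
    rw [← shanks h0 h1 n, Finset.sum_range_succ']
    have e : FF q n 0 = QQ q n := by simp [FF, cc, QQ]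
    rw [e, add_sub_cancel_right]
    refine (Finset.abs_sum_le_sum_abs _ _).trans ?_
    have : ∀ s ∈ Finset.range n, |FF q n (s + 1)| ≤ 2 * q ^ n := by
      intro s hs
      have hs := Finset.mem_range.1 hs
      rw [FF, cc, if_neg (Nat.succ_ne_zero s), abs_mul, abs_mul, abs_mul, abs_pow, abs_neg, abs_one, one_pow, one_mul,
        abs_of_pos (by positivity), abs_of_pos (div_pos (QQ_pos h0 h1 _) (QQ_pos h0 h1 _)),
        abs_of_pos (by positivity)]
      have c1 : 2 / (1 + q ^ (s + 1)) ≤ 2 := by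
        have := pow_pos h0 (s + 1)
        rw [div_le_iff₀ (by positivity)]; linarith
      have c2 : QQ q n / QQ q (s + 1) ≤ 1 := by
        rw [div_le_one (QQ_pos h0 h1 _)]; exact QQ_anti h0 h1 hs
      have c3 : q ^ ((s + 1) * (n + 1)) ≤ q ^ n := pow_le_pow_of_le_one h0.le h1.le (by nlinarith)
      have c4 := div_pos (QQ_pos h0 h1 n) (QQ_pos h0 h1 (s + 1))
      calc _ ≤ 2 * 1 * q ^ n := by gcongr
        _ = _ := by ring
    refine (Finset.sum_le_sum this).trans ?_
    simp; linarith
  have z : Tendsto (fun n : ℕ => 2 * ((n : ℝ) * q ^ n)) atTop (𝓝 0) := by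
    have := (tendsto_self_mul_const_pow_of_abs_lt_one (r := q) (by rwa [abs_of_pos h0])).const_mul 2
    simpa using this
  have := squeeze_zero_norm (f := fun n : ℕ => (1 + 2 * ∑ s ∈ Finset.range n, (-1) ^ (s + 1) * q ^ ((s + 1) ^ 2)) - QQ q n) key z
  simpa using this.add a

end
end RF

namespace RF
open Filter Topology

section
variable {q : ℝ} (h0 : 0 < q) (h1 : q < 1)
include h0 h1

lemma pow_lt1 {k : ℕ} (hk : k ≠ 0) : 0 < q ^ k ∧ q ^ k < 1 := ⟨pow_pos h0 k, pow_lt_one₀ h0.le h1 hk⟩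

lemma thn_sq : thn (q ^ 2) ^ 2 = th q * thn q := by
  obtain ⟨g0, g1⟩ := sq_lt1 h0 h1
  have a := R1 h0 h1
  have b := R2 g0 g1
  have c := conic h0 h1
  rw [← pow_mul] at b
  linear_combination b - c - th q * a

lemma th_eq : th q = EE (q ^ 2) ^ 5 / (EE q ^ 2 * EE (q ^ 4) ^ 2) := by
  obtain ⟨g0, g1⟩ := sq_lt1 h0 h1
  have h4 := pow_lt1 h0 h1 (k := 4) (by norm_num)
  have a := thn_sq h0 h1
  rw [thn_eq h0 h1, thn_eq g0 g1, ← pow_mul] at a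
  norm_num at a
  have e1 := EE_pos h0 h1
  have e2 := EE_pos g0 g1
  have e4 := EE_pos h4.1 h4.2
  field_simp at a
  rw [eq_div_iff (by positivity)]
  linear_combination -a

/-- product for `φ(q)^2 - φ(q^2)^2` -/
lemma DD_fun : (th q ^ 2 - th (q ^ 2) ^ 2) ^ 2 = 4 * th (q ^ 4) ^ 2 * (th (q ^ 2) ^ 2 - th (q ^ 4) ^ 2) := by
  have c := conic h0 h1
  have e : th q ^ 2 - th (q ^ 2) ^ 2 = 2 * th (q ^ 4) * (th q - th (q ^ 4)) := by linear_combination -c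
  rw [e]
  linear_combination (- 4 * th (q ^ 4) ^ 2) * c

end

/-- ratio -/
noncomputable def rr (q : ℝ) : ℝ :=
  (th q ^ 2 - th (q ^ 2) ^ 2) / (4 * q * EE (q ^ 8) ^ 4 / EE (q ^ 4) ^ 2)

section
variable {q : ℝ} (h0 : 0 < q) (h1 : q < 1)
include h0 h1

lemma rr_sq : rr q ^ 2 = rr (q ^ 2) := by
  have h4 := pow_lt1 h0 h1 (k := 4) (by norm_num)
  have h8 := pow_lt1 h0 h1 (k := 8) (by norm_num)
  have h16 := pow_lt1 h0 h1 (k := 16) (by norm_num)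
  have e4 := EE_pos h4.1 h4.2
  have e8 := EE_pos h8.1 h8.2
  have e16 := EE_pos h16.1 h16.2
  have a := DD_fun h0 h1
  have b := th_eq h4.1 h4.2
  unfold rr
  simp only [← pow_mul] at a b ⊢
  norm_num at a b ⊢
  rw [div_pow, a, b]
  field_simp

lemma rr_bound (h2 : q ≤ 1 / 4) : 2 / 9 ≤ rr q ∧ rr q ≤ 31 := by
  have h4 := pow_lt1 h0 h1 (k := 4) (by norm_num)
  have h8 := pow_lt1 h0 h1 (k := 8) (by norm_num)
  have q4 : q ^ 4 ≤ q / 64 := by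
    have : q ^ 3 ≤ (1 / 4) ^ 3 := pow_le_pow_left₀ h0.le h2 3
    nlinarith
  have q8 : q ^ 8 ≤ 1 / 4 := (pow_le_of_le_one h0.le h1.le (by norm_num)).trans h2
  have e4 := EE_pos h4.1 h4.2
  have e8 := EE_pos h8.1 h8.2
  have u4 := EE_le_one h4.1 h4.2
  have u8 := EE_le_one h8.1 h8.2
  have l4 := EE_lower h4.1 h4.2 (by linarith)
  have l8 := EE_lower h8.1 h8.2 q8
  have c := conic h0 h1
  have e : th q ^ 2 - th (q ^ 2) ^ 2 = 2 * th (q ^ 4) * (th q - th (q ^ 4)) := by linear_combination -c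
  have a1 := th_lower h0 h1
  have a2 := th_upper h0 h1
  have b1 := th_lower h4.1 h4.2
  have b2 := th_upper h4.1 h4.2
  have d1 : q / (1 - q) ≤ 2 * q := by rw [div_le_iff₀ (by linarith)]; nlinarith
  have d2 : q ^ 4 / (1 - q ^ 4) ≤ 2 * q ^ 4 := by rw [div_le_iff₀ (by linarith)]; nlinarith
  have D1 : q ≤ th q - th (q ^ 4) := by linarith
  have D2 : th q - th (q ^ 4) ≤ 4 * q := by linarith
  have W1 : 1 ≤ th (q ^ 4) := by linarith
  have W2 : th (q ^ 4) ≤ 3 := by linarith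
  have F1 : 2 * q ≤ th q ^ 2 - th (q ^ 2) ^ 2 := by
    rw [e]; nlinarith [mul_nonneg (sub_nonneg.2 W1) (h0.le.trans D1)]
  have F2 : th q ^ 2 - th (q ^ 2) ^ 2 ≤ 24 * q := by
    rw [e]; nlinarith [mul_nonneg (sub_nonneg.2 W2) (h0.le.trans D1)]
  have p8 : EE (q ^ 8) ^ 4 ≤ 1 := pow_le_one₀ e8.le u8
  have p8' : (2 / 3) ^ 4 ≤ EE (q ^ 8) ^ 4 := pow_le_pow_left₀ (by norm_num) l8 4
  have p4 : EE (q ^ 4) ^ 2 ≤ 1 := pow_le_one₀ e4.le u4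
  have p4' : (2 / 3) ^ 2 ≤ EE (q ^ 4) ^ 2 := pow_le_pow_left₀ (by norm_num) l4 2
  have G1 : 4 * q * EE (q ^ 8) ^ 4 / EE (q ^ 4) ^ 2 ≤ 9 * q := by
    rw [div_le_iff₀ (by positivity)]
    have t1 := mul_le_mul_of_nonneg_left p8 (by positivity : 0 ≤ 4 * q)
    have t2 := mul_le_mul_of_nonneg_left p4' (by positivity : 0 ≤ 9 * q)
    linarith
  have G2 : 4 * q * (16 / 81) ≤ 4 * q * EE (q ^ 8) ^ 4 / EE (q ^ 4) ^ 2 := by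
    rw [le_div_iff₀ (by positivity)]
    have t1 := mul_le_mul_of_nonneg_left p8' (by positivity : 0 ≤ 4 * q)
    have t2 := mul_le_mul_of_nonneg_left p4 (by positivity : 0 ≤ 4 * q * (16 / 81))
    linarith
  have G0 : 0 < 4 * q * EE (q ^ 8) ^ 4 / EE (q ^ 4) ^ 2 := by positivity
  unfold rr
  rw [le_div_iff₀ G0, div_le_iff₀ G0]
  constructor <;> linarith

lemma rr_pow (k : ℕ) : rr q ^ (2 ^ k) = rr (q ^ (2 ^ k)) := by
  induction k with
  | zero => simp
  | succ k ih =>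
    have h := pow_lt1 h0 h1 (k := 2 ^ k) (by positivity)
    rw [pow_succ, pow_mul, ih, rr_sq h.1 h.2, ← pow_mul]

lemma rr_one : rr q = 1 := by
  have t2 : Tendsto (fun k : ℕ => 2 ^ k) atTop atTop := tendsto_pow_atTop_atTop_of_one_lt (by norm_num : 1 < 2)
  have tq := (tendsto_pow_atTop_nhds_zero_of_lt_one h0.le h1).comp t2
  have ev : ∀ᶠ k : ℕ in atTop, q ^ (2 ^ k) ≤ 1 / 4 := tq.eventually (eventually_le_nhds (by norm_num))
  have ev2 : ∀ᶠ k : ℕ in atTop, 2 / 9 ≤ rr q ^ (2 ^ k) ∧ rr q ^ (2 ^ k) ≤ 31 := by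
    filter_upwards [ev] with k hk
    rw [rr_pow h0 h1]
    exact rr_bound (pow_pos h0 _) (pow_lt_one₀ h0.le h1 (by positivity)) hk
  have pos : 0 ≤ rr q := by
    have h4 := pow_lt1 h0 h1 (k := 4) (by norm_num)
    have h8 := pow_lt1 h0 h1 (k := 8) (by norm_num)
    have e4 := EE_pos h4.1 h4.2
    have e8 := EE_pos h8.1 h8.2
    have a := th_lt h0 h1
    have b := th_pos (sq_lt1 h0 h1).1 (sq_lt1 h0 h1).2
    refine div_nonneg ?_ (by positivity)
    nlinarith
  rcases lt_trichotomy (rr q) 1 with h | h | h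
  · have := (tendsto_pow_atTop_nhds_zero_of_lt_one pos h).comp t2
    have e : ∀ᶠ k : ℕ in atTop, rr q ^ (2 ^ k) < 2 / 9 := this.eventually (eventually_lt_nhds (by norm_num))
    obtain ⟨k, hk, hk'⟩ := (e.and ev2).exists
    linarith [hk'.1]
  · exact h
  · have := (tendsto_pow_atTop_atTop_of_one_lt h).comp t2
    have e : ∀ᶠ k : ℕ in atTop, 31 < rr q ^ (2 ^ k) := this.eventually (eventually_gt_atTop 31)
    obtain ⟨k, hk, hk'⟩ := (e.and ev2).exists
    linarith [hk'.2]

lemma DD_eq : th q ^ 2 - th (q ^ 2) ^ 2 = 4 * q * EE (q ^ 8) ^ 4 / EE (q ^ 4) ^ 2 := by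
  have h4 := pow_lt1 h0 h1 (k := 4) (by norm_num)
  have h8 := pow_lt1 h0 h1 (k := 8) (by norm_num)
  have e4 := EE_pos h4.1 h4.2
  have e8 := EE_pos h8.1 h8.2
  have := rr_one h0 h1
  unfold rr at this
  rwa [div_eq_one_iff_eq (by positivity)] at this

lemma G_eq (k l : ℕ) : th q ^ k * th (q ^ 2) ^ l * (2 * th (q ^ 2) ^ 2 - th q ^ 2) * (th q ^ 2 - th (q ^ 2) ^ 2) / 4 =
    q * (EE (q ^ 2) ^ 5 / (EE q ^ 2 * EE (q ^ 4) ^ 2)) ^ k * (EE (q ^ 4) ^ 5 / (EE (q ^ 2) ^ 2 * EE (q ^ 8) ^ 2)) ^ l *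
     (EE q ^ 2 / EE (q ^ 2)) ^ 2 * (EE (q ^ 8) ^ 4 / EE (q ^ 4) ^ 2) := by
  obtain ⟨g0, g1⟩ := sq_lt1 h0 h1
  have a : 2 * th (q ^ 2) ^ 2 - th q ^ 2 = thn q ^ 2 := by linear_combination -(R2 h0 h1)
  have b := th_eq g0 g1
  simp only [← pow_mul] at b
  norm_num at b
  rw [a, DD_eq h0 h1, thn_eq h0 h1, th_eq h0 h1, b]
  ring

lemma G1_eq : q * (EE q ^ (-2 : ℤ) * EE (q ^ 2) ^ (11 : ℤ) * EE (q ^ 4) ^ (-3 : ℤ) * EE (q ^ 8) ^ (2 : ℤ)) =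
    th q ^ 3 * th (q ^ 2) * (2 * th (q ^ 2) ^ 2 - th q ^ 2) * (th q ^ 2 - th (q ^ 2) ^ 2) / 4 := by
  have h2 := pow_lt1 h0 h1 (k := 2) (by norm_num)
  have h4 := pow_lt1 h0 h1 (k := 4) (by norm_num)
  have h8 := pow_lt1 h0 h1 (k := 8) (by norm_num)
  have e1 := EE_pos h0 h1
  have e2 := EE_pos h2.1 h2.2
  have e4 := EE_pos h4.1 h4.2
  have e8 := EE_pos h8.1 h8.2
  have := G_eq h0 h1 3 1
  rw [pow_one] at this
  rw [this]
  simp only [zpow_neg, zpow_ofNat]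
  field_simp

lemma G2_eq : q * (EE q ^ (2 : ℤ) * EE (q ^ 2) ^ (-3 : ℤ) * EE (q ^ 4) ^ (11 : ℤ) * EE (q ^ 8) ^ (-2 : ℤ)) =
    th q * th (q ^ 2) ^ 3 * (2 * th (q ^ 2) ^ 2 - th q ^ 2) * (th q ^ 2 - th (q ^ 2) ^ 2) / 4 := by
  have h2 := pow_lt1 h0 h1 (k := 2) (by norm_num)
  have h4 := pow_lt1 h0 h1 (k := 4) (by norm_num)
  have h8 := pow_lt1 h0 h1 (k := 8) (by norm_num)
  have e1 := EE_pos h0 h1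
  have e2 := EE_pos h2.1 h2.2
  have e4 := EE_pos h4.1 h4.2
  have e8 := EE_pos h8.1 h8.2
  have := G_eq h0 h1 1 3
  rw [pow_one] at this
  rw [this]
  simp only [zpow_neg, zpow_ofNat]
  field_simp

end
end RF

namespace RF
open Filter Topology

lemma hasSum_prod' {β γ : Type} {u : β → ℝ} {v : γ → ℝ} {s t : ℝ} (hu : HasSum u s) (hv : HasSum v t)
    (nu : ∀ b, 0 ≤ u b) (nv : ∀ c, 0 ≤ v c) : HasSum (fun p : β × γ => u p.1 * v p.2) (s * t) :=
  hu.mul hv (hu.summable.mul_of_nonneg hv.summable nu nv)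

lemma hasSum_pi (k : ℕ) (g : Fin k → ℤ → ℝ) (s : Fin k → ℝ) (hg : ∀ i m, 0 ≤ g i m)
    (h : ∀ i, HasSum (g i) (s i)) :
    HasSum (fun v : Fin k → ℤ => ∏ i, g i (v i)) (∏ i, s i) := by
  induction k with
  | zero => simp
  | succ k ih =>
    have t := ih (fun i => g i.succ) (fun i => s i.succ) (fun i => hg i.succ) (fun i => h i.succ)
    have n2 : ∀ v : Fin k → ℤ, 0 ≤ ∏ i, g i.succ (v i) := fun v => Finset.prod_nonneg fun i _ => hg i.succ (v i)
    have := hasSum_prod' (h 0) t (hg 0) n2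
    rw [Fin.prod_univ_succ]
    refine ((Fin.consEquiv (fun _ : Fin (k + 1) => ℤ)).hasSum_iff
      (f := fun v : Fin (k + 1) → ℤ => ∏ i, g i (v i))).1 ?_
    refine this.congr_fun fun p => ?_
    simp [Fin.prod_univ_succ, Fin.consEquiv]

lemma hasSum_rep {q : ℝ} (h0 : 0 < q) (h1 : q < 1) (a : Fin 8 → ℕ) (ha : ∀ i, a i ≠ 0) :
    HasSum (fun n : ℕ => (repCount a n : ℝ) * q ^ n) (∏ i, th (q ^ a i)) := by
  have h := hasSum_pi 8 (fun i m => (q ^ a i) ^ (m ^ 2)) (fun i => th (q ^ a i))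
    (fun i m => (zpow_pos (pow_pos h0 _) _).le)
    (fun i => hth (pow_pos h0 _) (pow_lt_one₀ h0.le h1 (ha i)))
  let N : (Fin 8 → ℤ) → ℕ := fun v => ∑ i, a i * (v i).natAbs ^ 2
  have hN : ∀ v : Fin 8 → ℤ, ∏ i, (q ^ a i) ^ (v i ^ 2) = q ^ N v := by
    intro v
    rw [← Finset.prod_pow_eq_pow_sum]
    refine Finset.prod_congr rfl fun i _ => ?_
    have e : v i ^ 2 = (((v i).natAbs ^ 2 : ℕ) : ℤ) := by simp
    rw [e, zpow_natCast, pow_mul]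
  simp only [hN] at h
  have h2 := (Equiv.sigmaFiberEquiv N).hasSum_iff.2 h
  have hsum := h2.summable
  refine HasSum.sigma h2 (fun n => ?_)
  have hc : ∀ c : {v // N v = n}, ((fun v => q ^ N v) ∘ (Equiv.sigmaFiberEquiv N)) ⟨n, c⟩ = q ^ n := by
    intro c
    simp [Equiv.sigmaFiberEquiv, c.2]
  simp only [hc]
  have hs := hsum.sigma_factor n
  simp only [hc] at hs
  have fin : Finite {v // N v = n} := by
    by_contra hinf
    rw [not_finite_iff_infinite] at hinf
    exact (pow_pos h0 n).ne' ((summable_const_iff _).1 hs)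
  have e : repCount a n = Nat.card {v // N v = n} := by
    refine Nat.card_congr (Equiv.subtypeEquivRight fun v => ?_)
    simp only [N]
    rw [← Nat.cast_inj (R := ℤ)]
    push_cast
    simp
  have := Fintype.ofFinite {v // N v = n}
  rw [e, Nat.card_eq_fintype_card]
  have := hasSum_fintype (fun _ : {v // N v = n} => q ^ n)
  simpa using this

lemma coeff_zero {e : ℕ → ℝ} (h : ∀ q : ℝ, 0 < q → q < 1 → HasSum (fun n => e n * q ^ n) 0) (n : ℕ) :
    e n = 0 := by
  induction n using Nat.strong_induction_on with
  | _ n ih =>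
    have h2 : ∀ q : ℝ, 0 < q → q < 1 → HasSum (fun m => e (m + n) * q ^ m) 0 := by
      intro q h0 h1
      have a := (hasSum_nat_add_iff' n).2 (h q h0 h1)
      rw [Finset.sum_eq_zero (fun i hi => by rw [ih i (Finset.mem_range.1 hi), zero_mul]), sub_zero] at a
      have := a.mul_left (q ^ n)⁻¹
      rw [mul_zero] at this
      refine this.congr_fun fun m => ?_
      have := pow_pos h0 n
      rw [pow_add]; field_simp
    have sm := ((h2 (1 / 2) (by norm_num) (by norm_num)).summable.norm)
    have sm1 := (summable_nat_add_iff 1).2 sm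
    set M := ∑' m : ℕ, ‖e (m + 1 + n) * (1 / 2) ^ (m + 1)‖ with hM
    have key : ∀ q : ℝ, 0 < q → q < 1 / 2 → |e n| ≤ 2 * q * M := by
      intro q h0 h1
      have a := (hasSum_nat_add_iff' 1).2 (h2 q h0 (by linarith))
      simp only [Finset.sum_range_one, zero_add, pow_zero, mul_one, zero_sub] at a
      have b := (sm1.hasSum.mul_left (2 * q))
      have := tsum_of_norm_bounded b (f := fun m : ℕ => e (m + 1 + n) * q ^ (m + 1)) (fun m => by
        rw [norm_mul, norm_mul, norm_pow, norm_pow, Real.norm_of_nonneg h0.le, Real.norm_of_nonneg (by norm_num : (0:ℝ) ≤ 1 / 2)]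
        have t : q ^ (m + 1) = (2 * q) ^ (m + 1) * (1 / 2) ^ (m + 1) := by
          rw [← mul_pow]; congr 1; ring
        have t2 : (2 * q) ^ (m + 1) ≤ 2 * q := pow_le_of_le_one (by linarith) (by linarith) (by simp)
        rw [t]
        have : 0 ≤ ‖e (m + 1 + n)‖ * (1 / 2) ^ (m + 1) := by positivity
        nlinarith)
      rw [a.tsum_eq, norm_neg] at this
      exact this
    have hlim : Tendsto (fun q : ℝ => 2 * q * M) (𝓝[>] 0) (𝓝 0) := by
      have : ContinuousAt (fun q : ℝ => 2 * q * M) 0 := by fun_prop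
      have := this.tendsto
      simp only [mul_zero, zero_mul] at this
      exact this.mono_left nhdsWithin_le_nhds
    have : |e n| ≤ 0 := ge_of_tendsto hlim (by
      filter_upwards [Ioo_mem_nhdsGT (show (0:ℝ) < 1 / 2 by norm_num)] with q hq
      exact key q hq.1 hq.2)
    exact abs_eq_zero.1 (le_antisymm this (abs_nonneg _))

/-- coefficients without constant term -/
noncomputable def ZZ (g : ℕ → ℤ) (n : ℕ) : ℝ := if n = 0 then 0 else (g n : ℝ)

/-- coefficients of the series in `q ^ 2` -/
noncomputable def HH (g : ℕ → ℤ) (n : ℕ) : ℝ := if 2 ∣ n then ZZ g (n / 2) else 0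

lemma hasSum_ZZ {g : ℕ → ℤ} {q s : ℝ} (h : HasSum (fun n : ℕ => (g (n + 1) : ℝ) * q ^ (n + 1)) s) :
    HasSum (fun n => ZZ g n * q ^ n) s := by
  refine (hasSum_nat_add_iff' 1).1 ?_
  simpa [ZZ] using h

lemma hasSum_HH {g : ℕ → ℤ} {q s : ℝ} (h : HasSum (fun n : ℕ => (g (n + 1) : ℝ) * (q ^ 2) ^ (n + 1)) s) :
    HasSum (fun n => HH g n * q ^ n) s := by
  have h' := hasSum_ZZ h
  have inj : Function.Injective (fun n : ℕ => 2 * n) := fun a b h => by simpa using h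
  refine (inj.hasSum_iff ?_).1 (h'.congr_fun fun n => ?_)
  · intro n hn
    have : ¬ 2 ∣ n := fun ⟨k, hk⟩ => hn ⟨k, hk.symm⟩
    simp [HH, this]
  · simp [HH, pow_mul]

/-- eta on the imaginary axis -/
lemma eta_im (t : ℝ) (ht : 0 < t) (k : ℕ) (hk : k ≠ 0) :
    dedekindEta (k * (Complex.I * t)) =
      ((Real.exp (-(2 * Real.pi * t) / 24) ^ k * EE (Real.exp (-(2 * Real.pi * t)) ^ k) : ℝ) : ℂ) := by
  have q0 : 0 < Real.exp (-(2 * Real.pi * t)) := Real.exp_pos _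
  have q1 : Real.exp (-(2 * Real.pi * t)) < 1 := by
    rw [Real.exp_lt_one_iff]; have := Real.pi_pos; nlinarith [mul_pos this ht]
  have hq := pow_lt1 q0 q1 hk
  have hm := (EE_mult hq.1 hq.2).map_tprod Complex.ofRealHom Complex.continuous_ofReal
  unfold dedekindEta
  rw [Complex.ofReal_mul]
  congr 1
  · rw [← Real.exp_nat_mul, Complex.ofReal_exp]
    congr 1
    push_cast
    ring_nf
    rw [Complex.I_sq]; ring
  · unfold EE
    refine Eq.trans ?_ hm.symm
    refine tprod_congr fun m => ?_
    rw [← Real.exp_nat_mul, ← Real.exp_nat_mul]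
    simp only [Complex.ofRealHom_eq_coe]
    push_cast
    congr 2
    ring_nf
    rw [Complex.I_sq]; ring

lemma exp_im (t : ℝ) : Complex.exp (2 * Real.pi * Complex.I * (Complex.I * t)) =
    ((Real.exp (-(2 * Real.pi * t)) : ℝ) : ℂ) := by
  rw [Complex.ofReal_exp]
  congr 1
  push_cast
  ring_nf
  rw [Complex.I_sq]; ring

lemma eta_series (a : ℕ → ℤ) (e1 e2 e4 e8 : ℤ) (he : e1 + 2 * e2 + 4 * e4 + 8 * e8 = 24)
    (ha : ∀ z : ℂ, 0 < z.im →
      dedekindEta z ^ e1 * dedekindEta (2 * z) ^ e2 * dedekindEta (4 * z) ^ e4 * dedekindEta (8 * z) ^ e8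
        = ∑' m : ℕ, (a (m + 1) : ℂ) * Complex.exp (2 * Real.pi * Complex.I * z) ^ (m + 1))
    {q : ℝ} (h0 : 0 < q) (h1 : q < 1) :
    HasSum (fun n : ℕ => (a (n + 1) : ℝ) * q ^ (n + 1))
      (q * (EE q ^ e1 * EE (q ^ 2) ^ e2 * EE (q ^ 4) ^ e4 * EE (q ^ 8) ^ e8)) := by
  have hlog : Real.log q < 0 := Real.log_neg h0 h1
  obtain ⟨t, ht, hq⟩ : ∃ t : ℝ, 0 < t ∧ q = Real.exp (-(2 * Real.pi * t)) := by
    refine ⟨-Real.log q / (2 * Real.pi), by have := Real.pi_pos; apply div_pos <;> linarith, ?_⟩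
    have := Real.pi_pos.ne'
    rw [show -(2 * Real.pi * (-Real.log q / (2 * Real.pi))) = Real.log q by field_simp, Real.exp_log h0]
  have h := ha (Complex.I * t) (by simpa using ht)
  have i1 := eta_im t ht 1 (by norm_num)
  have i2 := eta_im t ht 2 (by norm_num)
  have i4 := eta_im t ht 4 (by norm_num)
  have i8 := eta_im t ht 8 (by norm_num)
  rw [← hq] at i1 i2 i4 i8
  simp only [Nat.cast_one, one_mul, pow_one, Nat.cast_ofNat] at i1 i2 i4 i8
  rw [i1, i2, i4, i8, exp_im, ← hq] at h
  set u := Real.exp (-(2 * Real.pi * t) / 24) with hu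
  have u0 : 0 < u := Real.exp_pos _
  have uq : u ^ (24 : ℤ) = q := by
    rw [hq, hu, zpow_ofNat, ← Real.exp_nat_mul]; congr 1; push_cast; ring
  have hR : ∑' m : ℕ, (a (m + 1) : ℝ) * q ^ (m + 1) =
      q * (EE q ^ e1 * EE (q ^ 2) ^ e2 * EE (q ^ 4) ^ e4 * EE (q ^ 8) ^ e8) := by
    have : (u * EE q) ^ e1 * (u ^ 2 * EE (q ^ 2)) ^ e2 * (u ^ 4 * EE (q ^ 4)) ^ e4 * (u ^ 8 * EE (q ^ 8)) ^ e8
        = ∑' m : ℕ, (a (m + 1) : ℝ) * q ^ (m + 1) := by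
      rw [← Complex.ofReal_inj, Complex.ofReal_tsum]
      push_cast at h ⊢
      exact h
    rw [← this, ← uq, ← he, zpow_add₀ u0.ne', zpow_add₀ u0.ne', zpow_add₀ u0.ne', zpow_mul, zpow_mul, zpow_mul,
      zpow_ofNat, zpow_ofNat, zpow_ofNat, mul_zpow, mul_zpow, mul_zpow, mul_zpow]
    ring
  have pos : 0 < q * (EE q ^ e1 * EE (q ^ 2) ^ e2 * EE (q ^ 4) ^ e4 * EE (q ^ 8) ^ e8) := by
    have h2 := pow_lt1 h0 h1 (k := 2) (by norm_num)
    have h4 := pow_lt1 h0 h1 (k := 4) (by norm_num)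
    have h8 := pow_lt1 h0 h1 (k := 8) (by norm_num)
    have e1 := EE_pos h0 h1
    have e2 := EE_pos h2.1 h2.2
    have e4 := EE_pos h4.1 h4.2
    have e8 := EE_pos h8.1 h8.2
    positivity
  have sm : Summable fun n : ℕ => (a (n + 1) : ℝ) * q ^ (n + 1) := by
    by_contra hs
    rw [tsum_eq_zero_of_not_summable hs] at hR
    linarith
  rw [← hR]
  exact sm.hasSum

lemma final_id (x y w : ℝ) (h : y ^ 2 = 2 * w ^ 2 - 2 * w * x + x ^ 2) :
    x * y ^ 5 * w ^ 2 = 8 / 11 * (x * y * (x ^ 2 - y ^ 2) * ((x ^ 2) ^ 2 + 4 * (x ^ 2 * y ^ 2) - (y ^ 2) ^ 2) / 16)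
      + 2 / 11 * (11 / 2 + (y * w * (2 * w ^ 2 - y ^ 2) * (4 * (w ^ 2) ^ 2 + 8 * (y ^ 2 * w ^ 2) - (y ^ 2) ^ 2) / 2 - 11 / 2))
      + 2 / 11 * (x ^ 3 * y * (2 * y ^ 2 - x ^ 2) * (x ^ 2 - y ^ 2) / 4)
      + 12 / 11 * (x * y ^ 3 * (2 * y ^ 2 - x ^ 2) * (x ^ 2 - y ^ 2) / 4)
      + 48 / 11 * (y ^ 3 * w * (2 * w ^ 2 - y ^ 2) * (y ^ 2 - w ^ 2) / 4)
      + 16 / 11 * (y * w ^ 3 * (2 * w ^ 2 - y ^ 2) * (y ^ 2 - w ^ 2) / 4) := by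
  have k : x * (y ^ 2) ^ 2 * w ^ 2 = 8 / 11 * (x * (x ^ 2 - y ^ 2) * ((x ^ 2) ^ 2 + 4 * (x ^ 2 * y ^ 2) - (y ^ 2) ^ 2) / 16)
      + 2 / 11 * (w * (2 * w ^ 2 - y ^ 2) * (4 * (w ^ 2) ^ 2 + 8 * (y ^ 2 * w ^ 2) - (y ^ 2) ^ 2) / 2)
      + 2 / 11 * (x ^ 3 * (2 * y ^ 2 - x ^ 2) * (x ^ 2 - y ^ 2) / 4)
      + 12 / 11 * (x * y ^ 2 * (2 * y ^ 2 - x ^ 2) * (x ^ 2 - y ^ 2) / 4)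
      + 48 / 11 * (y ^ 2 * w * (2 * w ^ 2 - y ^ 2) * (y ^ 2 - w ^ 2) / 4)
      + 16 / 11 * (w ^ 3 * (2 * w ^ 2 - y ^ 2) * (y ^ 2 - w ^ 2) / 4) := by
    rw [h]; ring
  linear_combination y * k

end RF

theorem representation_formula_2
    (a1 a2 : ℕ → ℤ)
    (ha1 : ∀ z : ℂ, 0 < z.im →
      dedekindEta z ^ (-2 : ℤ) * dedekindEta (2 * z) ^ (11 : ℤ) * dedekindEta (4 * z) ^ (-3 : ℤ) * dedekindEta (8 * z) ^ (2 : ℤ)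
        = ∑' m : ℕ, (a1 (m + 1) : ℂ) * Complex.exp (2 * Real.pi * Complex.I * z) ^ (m + 1))
    (ha2 : ∀ z : ℂ, 0 < z.im →
      dedekindEta z ^ (2 : ℤ) * dedekindEta (2 * z) ^ (-3 : ℤ) * dedekindEta (4 * z) ^ (11 : ℤ) * dedekindEta (8 * z) ^ (-2 : ℤ)
        = ∑' m : ℕ, (a2 (m + 1) : ℂ) * Complex.exp (2 * Real.pi * Complex.I * z) ^ (m + 1))
    (n : ℕ) (hn : 0 < n) :
    (repCount ![1, 2, 2, 2, 2, 2, 4, 4] n : ℚ) =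
    (((8 : ℚ) / 11) * (sigmaChi8One n : ℚ) + ((2 : ℚ) / 11) * half sigmaOneChi8 n
      + ((2 : ℚ) / 11) * (a1 n : ℚ) + ((12 : ℚ) / 11) * (a2 n : ℚ)
      + ((48 : ℚ) / 11) * half a1 n + ((16 : ℚ) / 11) * half a2 n) := by
  have key := RF.coeff_zero (e := fun n => (repCount ![1, 2, 2, 2, 2, 2, 4, 4] n : ℝ) -
    (8 / 11 * RF.ZZ RF.sig1 n + 2 / 11 * (11 / 2 * (if n = 0 then 1 else 0) + RF.HH RF.sig2 n)
      + 2 / 11 * RF.ZZ a1 n + 12 / 11 * RF.ZZ a2 n + 48 / 11 * RF.HH a1 n + 16 / 11 * RF.HH a2 n)) (by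
    intro q h0 h1
    obtain ⟨g0, g1⟩ := RF.sq_lt1 h0 h1
    have k4 := RF.pow_lt1 h0 h1 (k := 4) (by norm_num)
    have e22 : (q ^ 2) ^ 2 = q ^ 4 := by ring
    have r := RF.hasSum_rep h0 h1 ![1, 2, 2, 2, 2, 2, 4, 4] (by decide)
    have er : ∏ i, RF.th (q ^ (![1, 2, 2, 2, 2, 2, 4, 4] : Fin 8 → ℕ) i) =
        RF.th q * RF.th (q ^ 2) ^ 5 * RF.th (q ^ 4) ^ 2 := by
      simp [Fin.prod_univ_succ]; ring
    rw [er] at r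
    have f1 := RF.hasSum_ZZ (RF.F1_eq h0 h1)
    rw [RF.L_eq_th h0 h1, RF.A_eq_th_sq h0 h1, RF.A_eq_th_sq g0 g1] at f1
    have f2 := RF.hasSum_HH (RF.F2_eq g0 g1)
    rw [RF.L_eq_th g0 g1, RF.A_eq_th_sq g0 g1, e22, RF.A_eq_th_sq k4.1 k4.2] at f2
    have b1 := RF.eta_series a1 (-2) 11 (-3) 2 (by norm_num) ha1 h0 h1
    have b2 := RF.eta_series a2 2 (-3) 11 (-2) (by norm_num) ha2 h0 h1
    have c1 := RF.eta_series a1 (-2) 11 (-3) 2 (by norm_num) ha1 g0 g1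
    have c2 := RF.eta_series a2 2 (-3) 11 (-2) (by norm_num) ha2 g0 g1
    rw [RF.G1_eq h0 h1] at b1
    rw [RF.G2_eq h0 h1] at b2
    rw [RF.G1_eq g0 g1, e22] at c1
    rw [RF.G2_eq g0 g1, e22] at c2
    have o : HasSum (fun n : ℕ => if n = 0 then (1 : ℝ) else 0) 1 := hasSum_ite_eq 0 1
    have tot := r.sub ((((((f1.mul_left (8 / 11)).add (((o.mul_left (11 / 2)).add f2).mul_left (2 / 11))).add
      ((RF.hasSum_ZZ b1).mul_left (2 / 11))).add ((RF.hasSum_ZZ b2).mul_left (12 / 11))).add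
      ((RF.hasSum_HH c1).mul_left (48 / 11))).add ((RF.hasSum_HH c2).mul_left (16 / 11)))
    have fin := RF.final_id (RF.th q) (RF.th (q ^ 2)) (RF.th (q ^ 4)) (RF.conic h0 h1)
    rw [mul_one, sub_eq_zero.2 fin] at tot
    refine tot.congr_fun fun n => ?_
    have : (if n = 0 then (1 : ℝ) else 0) * q ^ n = if n = 0 then (1 : ℝ) else 0 := by
      split_ifs with hn0
      · simp [hn0]
      · simp
    linear_combination (-1) * this) n
  have hn0 : n ≠ 0 := hn.ne'
  have hZ : ∀ g : ℕ → ℤ, RF.ZZ g n = ((g n : ℚ) : ℝ) := fun g => by simp [RF.ZZ, hn0]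
  have hH : ∀ g : ℕ → ℤ, RF.HH g n = ((half g n : ℚ) : ℝ) := by
    intro g
    unfold RF.HH half RF.ZZ
    by_cases hd : 2 ∣ n
    · have : n / 2 ≠ 0 := by omega
      simp [hd, this]
    · simp [hd]
  have s1 : RF.sig1 = sigmaChi8One := rfl
  have s2 : RF.sig2 = sigmaOneChi8 := rfl
  simp only [hZ, hH, if_neg hn0, s1, s2, mul_zero, zero_add] at key
  have key2 := sub_eq_zero.1 key
  apply Rat.cast_injective (α := ℝ)
  push_cast at key2 ⊢
  linarith
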